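/- Let f_{B^t} ∈ (RatFunc ℚ)[x] be the polynomial f_{B^t}(s,x) = 5^2·(2500x^12 - 45000x^10 + 310500x^8 - 1001700x^6 + 1433700x^4 - 641520x^2 + 174960x + 88209) - 270·s·(12x+25)·(50x^6 - 450x^4 + 1080x^2 - 297) + 3^6·s^2·(12x-25)^2, where s denotes the generator of the rational function field ℚ(s). Then the Galois group of f_{B^t} over ℚ(s) has cardinality 95040 (the order of the Mathieu group M₁₂). -/

import Mathlib

open Polynomial

/-! ### Permutation groups of degree twelve -/

/-- `H` contains a permutation conjugate to `c`. -/
def MeetsConjClass (H : Subgroup (Equiv.Perm (Fin 12))) (c : Equiv.Perm (Fin 12)) : Prop :=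
  ∃ g ∈ H, ∃ e : Equiv.Perm (Fin 12), ∀ i, g (e i) = e (c i)

/-- `H` is transitive on injective `k`-tuples. -/
def TransitiveOnTuples (H : Subgroup (Equiv.Perm (Fin 12))) (k : ℕ) : Prop :=
  ∀ x y : Fin k ↪ Fin 12, ∃ h ∈ H, ∀ i, h (x i) = y i

/-- The orbit of `b` under the pointwise stabiliser of the tuple `x` in `H`. -/
def tupleOrbit (H : Subgroup (Equiv.Perm (Fin 12))) {k : ℕ} (x : Fin k ↪ Fin 12) (b : Fin 12) :
    Set (Fin 12) :=
  {d | ∃ h ∈ H, (∀ i, h (x i) = x i) ∧ h b = d}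

/-- A permutation of cycle type `(11, 1)`. -/
def cyclePerm11 : Equiv.Perm (Fin 12) :=
  ⟨![1, 2, 3, 4, 5, 6, 7, 8, 9, 10, 0, 11], ![10, 0, 1, 2, 3, 4, 5, 6, 7, 8, 9, 11],
    by decide, by decide⟩

/-- A permutation of cycle type `(10, 2)`. -/
def cyclePerm10 : Equiv.Perm (Fin 12) :=
  ⟨![1, 2, 3, 4, 5, 6, 7, 8, 9, 0, 11, 10], ![9, 0, 1, 2, 3, 4, 5, 6, 7, 8, 11, 10],
    by decide, by decide⟩

/-- A permutation of cycle type `(8, 2, 1, 1)`. -/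
def cyclePerm8 : Equiv.Perm (Fin 12) :=
  ⟨![1, 2, 3, 4, 5, 6, 7, 0, 9, 8, 10, 11], ![7, 0, 1, 2, 3, 4, 5, 6, 9, 8, 10, 11],
    by decide, by decide⟩

/-- A permutation of cycle type `(6, 3, 2, 1)`. -/
def cyclePerm6 : Equiv.Perm (Fin 12) :=
  ⟨![1, 2, 3, 4, 5, 0, 7, 8, 6, 10, 9, 11], ![5, 0, 1, 2, 3, 4, 8, 6, 7, 10, 9, 11],
    by decide, by decide⟩

section

variable {H : Subgroup (Equiv.Perm (Fin 12))}

theorem pow_apply_of_conj {g e c : Equiv.Perm (Fin 12)} (he : ∀ i, g (e i) = e (c i)) (n : ℕ) :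
    ∀ i, (g ^ n) (e i) = e ((c ^ n) i) := by
  induction n with
  | zero => simp
  | succ n ih =>
    intro i
    rw [pow_succ, pow_succ, Equiv.Perm.mul_apply, Equiv.Perm.mul_apply, he, ih]

theorem MeetsConjClass.pow {c : Equiv.Perm (Fin 12)} (h : MeetsConjClass H c) (n : ℕ) :
    MeetsConjClass H (c ^ n) := by
  obtain ⟨g, hg, e, he⟩ := h
  exact ⟨g ^ n, H.pow_mem hg n, e, pow_apply_of_conj he n⟩

theorem TransitiveOnTuples.exists_conj {k : ℕ} (hT : TransitiveOnTuples H k)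
    {c : Equiv.Perm (Fin 12)} (hc : MeetsConjClass H c) (f x : Fin k ↪ Fin 12) :
    ∃ g ∈ H, ∃ e : Equiv.Perm (Fin 12), (∀ i, g (e i) = e (c i)) ∧ ∀ j, e (f j) = x j := by
  obtain ⟨g, hg, e, he⟩ := hc
  obtain ⟨h, hh, hx⟩ := hT (f.trans e.toEmbedding) x
  refine ⟨h * g * h⁻¹, H.mul_mem (H.mul_mem hh hg) (H.inv_mem hh), h * e, ?_, ?_⟩
  · intro i
    simp [he]
  · intro j
    simpa using hx j

theorem TransitiveOnTuples.tupleOrbit_pullback {k : ℕ} (hT : TransitiveOnTuples H k)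
    {c : Equiv.Perm (Fin 12)} (hc : MeetsConjClass H c) (f x : Fin k ↪ Fin 12)
    (hf : ∀ j, c (f j) = f j) {b : Fin 12} (hb : ∀ j, x j ≠ b) :
    ∃ s : Fin 12 → Bool, (∀ i, s (c i) = s i) ∧ (∀ j, s (f j) = false) ∧
      (∑ i, (s i).toNat) = (tupleOrbit H x b).ncard := by
  classical
  obtain ⟨g, hg, e, he, hx⟩ := hT.exists_conj hc f x
  have hgx : ∀ j, g (x j) = x j := fun j => by rw [← hx, he, hf]
  refine ⟨fun i => decide (e i ∈ tupleOrbit H x b), fun i => ?_, fun j => ?_, ?_⟩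
  · rw [decide_eq_decide, ← he]
    constructor
    · rintro ⟨h, hh, h1, h2⟩
      refine ⟨g⁻¹ * h, H.mul_mem (H.inv_mem hg) hh, fun j => ?_, ?_⟩
      · rw [Equiv.Perm.mul_apply, h1, Equiv.Perm.inv_eq_iff_eq, hgx]
      · rw [Equiv.Perm.mul_apply, h2, Equiv.Perm.inv_eq_iff_eq]
    · rintro ⟨h, hh, h1, h2⟩
      exact ⟨g * h, H.mul_mem hg hh, fun j => by rw [Equiv.Perm.mul_apply, h1, hgx],
        by rw [Equiv.Perm.mul_apply, h2]⟩
  · rw [decide_eq_false_iff_not, hx]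
    rintro ⟨h, hh, h1, h2⟩
    exact hb j (h.injective ((h1 j).trans h2.symm))
  · rw [Set.ncard_eq_toFinset_card', ← Finset.card_map e.symm.toEmbedding, Finset.card_eq_sum_ones,
      ← Finset.sum_subset (Finset.subset_univ
        ((tupleOrbit H x b).toFinset.map e.symm.toEmbedding))]
    · refine Finset.sum_congr rfl fun i hi => ?_
      simp only [Finset.mem_map_equiv, Equiv.symm_symm, Set.mem_toFinset] at hi
      simp [hi]
    · intro i _ hi
      simp only [Finset.mem_map_equiv, Equiv.symm_symm, Set.mem_toFinset] at hi
      simp [hi]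

theorem tupleOrbit_pos {k : ℕ} (x : Fin k ↪ Fin 12) (b : Fin 12) :
    0 < (tupleOrbit H x b).ncard :=
  (Set.ncard_pos (Set.toFinite _)).2 ⟨b, 1, H.one_mem, by simp, rfl⟩

theorem TransitiveOnTuples.succ {k : ℕ} (hT : TransitiveOnTuples H k)
    (h : ∀ (x : Fin k ↪ Fin 12) (b : Fin 12), (∀ j, x j ≠ b) →
      (tupleOrbit H x b).ncard = 12 - k) : TransitiveOnTuples H (k + 1) := by
  intro x y
  let c : Fin k ↪ Fin (k + 1) := Fin.castSuccEmb
  obtain ⟨g, hg, hgx⟩ := hT (c.trans x) (c.trans y)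
  have hne : ∀ j, (c.trans y) j ≠ g (x (Fin.last k)) := by
    intro j hj
    rw [← hgx] at hj
    have := x.injective (g.injective hj)
    exact (Fin.castSucc_lt_last j).ne this
  have hne' : y (Fin.last k) ∈ (Set.range (c.trans y))ᶜ := by
    rintro ⟨j, hj⟩
    exact (Fin.castSucc_lt_last j).ne (y.injective hj)
  have hsub : tupleOrbit H (c.trans y) (g (x (Fin.last k))) ⊆ (Set.range (c.trans y))ᶜ := by
    rintro d ⟨h, hh, h1, h2⟩ ⟨j, hj⟩
    rw [← hj, ← h1] at h2
    exact hne j (h.injective h2).symm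
  have heq := Set.eq_of_subset_of_ncard_le hsub (by
    rw [h _ _ hne, Set.ncard_compl, ← Set.image_univ,
      Set.ncard_image_of_injective _ (c.trans y).injective]
    simp)
  rw [← heq] at hne'
  obtain ⟨h', hh', h1, h2⟩ := hne'
  refine ⟨h' * g, H.mul_mem hh' hg, fun i => ?_⟩
  refine Fin.lastCases ?_ (fun j => ?_) i
  · simpa using h2
  · have := hgx j
    simp only [Function.Embedding.trans_apply] at this
    have h3 := h1 j
    simp only [Function.Embedding.trans_apply] at h3
    simp only [Equiv.Perm.mul_apply]
    exact (congrArg h' this).trans h3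

theorem TransitiveOnTuples.of_succ {k : ℕ} (hk : k < 12) (hT : TransitiveOnTuples H (k + 1)) :
    TransitiveOnTuples H k := by
  have key : ∀ x : Fin k ↪ Fin 12, ∃ y : Fin (k + 1) ↪ Fin 12, ∀ i, y (Fin.castSucc i) = x i := by
    intro x
    obtain ⟨b, hb⟩ : ∃ b, b ∉ Set.range x := by
      by_contra! h
      have := Fintype.card_le_of_surjective x h
      simp at this
      omega
    exact ⟨⟨Fin.snoc x b, Fin.snoc_injective_iff.2 ⟨x.injective, hb⟩⟩, fun i => by simp⟩
  intro x y
  obtain ⟨x', hx⟩ := key x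
  obtain ⟨y', hy⟩ := key y
  obtain ⟨h, hh, hxy⟩ := hT x' y'
  exact ⟨h, hh, fun i => by rw [← hx, ← hy, hxy]⟩

theorem transitiveOnTuples_zero : TransitiveOnTuples H 0 :=
  fun _ _ => ⟨1, H.one_mem, fun i => i.elim0⟩

/-- The embedding of `Fin k` enumerating the points `12 - k, …, 11`. -/
def lastPoints (k : ℕ) (hk : k ≤ 12) : Fin k ↪ Fin 12 :=
  ⟨fun i => ⟨12 - k + i, by omega⟩, fun i j h => by
    simp only [Fin.mk.injEq] at h
    exact Fin.ext (by omega)⟩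

theorem sum_fin_twelve (f : Fin 12 → ℕ) : ∑ i, f i =
    f 0 + f 1 + f 2 + f 3 + f 4 + f 5 + f 6 + f 7 + f 8 + f 9 + f 10 + f 11 := by
  rw [Fin.sum_univ_castSucc, Fin.sum_univ_castSucc, Fin.sum_univ_castSucc, Fin.sum_univ_castSucc,
    Fin.sum_univ_eight]
  rfl

theorem sum_of_cyclePerm11 {s : Fin 12 → Bool} (h : ∀ i, s (cyclePerm11 i) = s i) :
    ∑ i, (s i).toNat = 11 * (s 0).toNat + (s 11).toNat := by
  have h1 : s 1 = s 0 := h 0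
  have h2 : s 2 = s 1 := h 1
  have h3 : s 3 = s 2 := h 2
  have h4 : s 4 = s 3 := h 3
  have h5 : s 5 = s 4 := h 4
  have h6 : s 6 = s 5 := h 5
  have h7 : s 7 = s 6 := h 6
  have h8 : s 8 = s 7 := h 7
  have h9 : s 9 = s 8 := h 8
  have h10 : s 10 = s 9 := h 9
  rw [sum_fin_twelve, h10, h9, h8, h7, h6, h5, h4, h3, h2, h1]
  ring

theorem sum_of_cyclePerm10 {s : Fin 12 → Bool} (h : ∀ i, s (cyclePerm10 i) = s i) :
    ∑ i, (s i).toNat = 10 * (s 0).toNat + 2 * (s 10).toNat := by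
  have h1 : s 1 = s 0 := h 0
  have h2 : s 2 = s 1 := h 1
  have h3 : s 3 = s 2 := h 2
  have h4 : s 4 = s 3 := h 3
  have h5 : s 5 = s 4 := h 4
  have h6 : s 6 = s 5 := h 5
  have h7 : s 7 = s 6 := h 6
  have h8 : s 8 = s 7 := h 7
  have h9 : s 9 = s 8 := h 8
  have h11 : s 11 = s 10 := h 10
  rw [sum_fin_twelve, h11, h9, h8, h7, h6, h5, h4, h3, h2, h1]
  ring

theorem sum_of_cyclePerm10_sq {s : Fin 12 → Bool} (h : ∀ i, s ((cyclePerm10 ^ 2) i) = s i) :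
    ∑ i, (s i).toNat = 5 * (s 0).toNat + 5 * (s 1).toNat + (s 10).toNat + (s 11).toNat := by
  have h2 : s 2 = s 0 := h 0
  have h3 : s 3 = s 1 := h 1
  have h4 : s 4 = s 2 := h 2
  have h5 : s 5 = s 3 := h 3
  have h6 : s 6 = s 4 := h 4
  have h7 : s 7 = s 5 := h 5
  have h8 : s 8 = s 6 := h 6
  have h9 : s 9 = s 7 := h 7
  rw [sum_fin_twelve, h9, h8, h7, h6, h5, h4, h3, h2]
  ring

theorem sum_of_cyclePerm8 {s : Fin 12 → Bool} (h : ∀ i, s (cyclePerm8 i) = s i) :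
    ∑ i, (s i).toNat = 8 * (s 0).toNat + 2 * (s 8).toNat + (s 10).toNat + (s 11).toNat := by
  have h1 : s 1 = s 0 := h 0
  have h2 : s 2 = s 1 := h 1
  have h3 : s 3 = s 2 := h 2
  have h4 : s 4 = s 3 := h 3
  have h5 : s 5 = s 4 := h 4
  have h6 : s 6 = s 5 := h 5
  have h7 : s 7 = s 6 := h 6
  have h9 : s 9 = s 8 := h 8
  rw [sum_fin_twelve, h9, h7, h6, h5, h4, h3, h2, h1]
  ring

theorem sum_of_cyclePerm8_sq {s : Fin 12 → Bool} (h : ∀ i, s ((cyclePerm8 ^ 2) i) = s i) :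
    ∑ i, (s i).toNat = 4 * (s 0).toNat + 4 * (s 1).toNat + (s 8).toNat + (s 9).toNat +
      (s 10).toNat + (s 11).toNat := by
  have h2 : s 2 = s 0 := h 0
  have h3 : s 3 = s 1 := h 1
  have h4 : s 4 = s 2 := h 2
  have h5 : s 5 = s 3 := h 3
  have h6 : s 6 = s 4 := h 4
  have h7 : s 7 = s 5 := h 5
  rw [sum_fin_twelve, h7, h6, h5, h4, h3, h2]
  ring

theorem sum_of_cyclePerm6_sq {s : Fin 12 → Bool} (h : ∀ i, s ((cyclePerm6 ^ 2) i) = s i) :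
    ∑ i, (s i).toNat = 3 * (s 0).toNat + 3 * (s 1).toNat + 3 * (s 6).toNat + (s 9).toNat +
      (s 10).toNat + (s 11).toNat := by
  have h2 : s 2 = s 0 := h 0
  have h3 : s 3 = s 1 := h 1
  have h4 : s 4 = s 2 := h 2
  have h5 : s 5 = s 3 := h 3
  have h8 : s 8 = s 6 := h 6
  have h7 : s 7 = s 8 := h 8
  rw [sum_fin_twelve, h7, h8, h5, h4, h3, h2]
  ring

theorem transitiveOnTuples_four (h11 : MeetsConjClass H cyclePerm11)
    (h10 : MeetsConjClass H cyclePerm10) (h8 : MeetsConjClass H cyclePerm8)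
    (h6 : MeetsConjClass H cyclePerm6) : TransitiveOnTuples H 4 := by
  have t1 : TransitiveOnTuples H 1 := by
    refine transitiveOnTuples_zero.succ fun x b hb => ?_
    obtain ⟨s, hs, -, hs2⟩ := transitiveOnTuples_zero.tupleOrbit_pullback h11 x x
      (fun j => j.elim0) hb
    obtain ⟨t, ht, -, ht2⟩ := transitiveOnTuples_zero.tupleOrbit_pullback h10 x x
      (fun j => j.elim0) hb
    have hpos := tupleOrbit_pos (H := H) x b
    rw [sum_of_cyclePerm11 hs] at hs2
    rw [sum_of_cyclePerm10 ht] at ht2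
    have := (s 0).toNat_le
    have := (s 11).toNat_le
    have := (t 0).toNat_le
    have := (t 10).toNat_le
    interval_cases (s 0).toNat <;> omega
  have t2 : TransitiveOnTuples H 2 := by
    refine t1.succ fun x b hb => ?_
    obtain ⟨s, hs, hs1, hs2⟩ := t1.tupleOrbit_pullback h11 (lastPoints 1 (by simp)) x
      (by decide) hb
    have hpos := tupleOrbit_pos (H := H) x b
    have h0 : s 11 = false := hs1 0
    rw [sum_of_cyclePerm11 hs, h0] at hs2
    have := (s 0).toNat_le
    simp only [Bool.toNat_false] at hs2
    omega
  have t3 : TransitiveOnTuples H 3 := by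
    refine t2.succ fun x b hb => ?_
    obtain ⟨s, hs, hs1, hs2⟩ := t2.tupleOrbit_pullback (h10.pow 2) (lastPoints 2 (by simp)) x
      (by decide) hb
    obtain ⟨t, ht, ht1, ht2⟩ := t2.tupleOrbit_pullback h8 (lastPoints 2 (by simp)) x
      (by decide) hb
    have hpos := tupleOrbit_pos (H := H) x b
    have s0 : s 10 = false := hs1 0
    have s1 : s 11 = false := hs1 1
    have t0 : t 10 = false := ht1 0
    have t1 : t 11 = false := ht1 1
    rw [sum_of_cyclePerm10_sq hs, s0, s1] at hs2
    rw [sum_of_cyclePerm8 ht, t0, t1] at ht2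
    have := (s 0).toNat_le
    have := (s 1).toNat_le
    have := (t 0).toNat_le
    have := (t 8).toNat_le
    simp only [Bool.toNat_false] at hs2 ht2
    omega
  refine t3.succ fun x b hb => ?_
  obtain ⟨s, hs, hs1, hs2⟩ := t3.tupleOrbit_pullback (h6.pow 2) (lastPoints 3 (by simp)) x
    (by decide) hb
  obtain ⟨t, ht, ht1, ht2⟩ := t3.tupleOrbit_pullback (h8.pow 2) (lastPoints 3 (by simp)) x
    (by decide) hb
  have hpos := tupleOrbit_pos (H := H) x b
  have s0 : s 9 = false := hs1 0
  have s1 : s 10 = false := hs1 1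
  have s2 : s 11 = false := hs1 2
  have t0 : t 9 = false := ht1 0
  have t1 : t 10 = false := ht1 1
  have t2 : t 11 = false := ht1 2
  rw [sum_of_cyclePerm6_sq hs, s0, s1, s2] at hs2
  rw [sum_of_cyclePerm8_sq ht, t0, t1, t2] at ht2
  have := (s 0).toNat_le
  have := (s 1).toNat_le
  have := (s 6).toNat_le
  have := (t 0).toNat_le
  have := (t 1).toNat_le
  have := (t 8).toNat_le
  simp only [Bool.toNat_false] at hs2 ht2
  interval_cases (t 0).toNat <;> interval_cases (t 1).toNat <;> omega

theorem TransitiveOnTuples.card_eq {k : ℕ} (hT : TransitiveOnTuples H k) (x : Fin k ↪ Fin 12) :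
    Nat.card H * (12 - k).factorial = Nat.factorial 12 *
      Nat.card (fixingSubgroup H (Set.range x)) := by
  have hT' : MulAction.IsMultiplyPretransitive H (Fin 12) k := by
    refine ⟨fun x y => ?_⟩
    obtain ⟨h, hh, hxy⟩ := hT x y
    exact ⟨⟨h, hh⟩, by ext i; exact congrArg Fin.val (hxy i)⟩
  have hx : (Set.range x).ncard = k := by
    rw [← Set.image_univ, Set.ncard_image_of_injective _ x.injective]
    simp
  have := hT'.index_of_fixingSubgroup_mul hx
  rw [Nat.card_eq_fintype_card, Fintype.card_fin] at this
  rw [← this, ← (fixingSubgroup H (Set.range x)).index_mul_card]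
  ring

theorem dvd_card_of_fourfold (h8 : MeetsConjClass H cyclePerm8) (t2 : TransitiveOnTuples H 2)
    (t4 : TransitiveOnTuples H 4) : 47520 ∣ Nat.card H := by
  obtain ⟨g, hg, e, he⟩ := h8
  have hpow := pow_apply_of_conj he
  let x : Fin 2 ↪ Fin 12 := (lastPoints 2 (by simp)).trans e.toEmbedding
  have hfix : (⟨g, hg⟩ : H) ∈ fixingSubgroup H (Set.range x) := by
    rw [mem_fixingSubgroup_iff]
    rintro _ ⟨j, rfl⟩
    change g (e _) = e _
    rw [he]
    fin_cases j <;> rfl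
  have h8 : 8 ∣ Nat.card (fixingSubgroup H (Set.range x)) := by
    have : orderOf (⟨_, hfix⟩ : fixingSubgroup H (Set.range x)) = 2 ^ (2 + 1) := by
      rw [Subgroup.orderOf_mk, Subgroup.orderOf_mk]
      apply orderOf_eq_prime_pow
      · intro h
        have := hpow (2 ^ 2) 0
        rw [h, Equiv.Perm.one_apply] at this
        exact absurd (e.injective this) (by decide)
      · ext i
        obtain ⟨j, rfl⟩ := e.surjective i
        rw [hpow]
        have : cyclePerm8 ^ (2 ^ (2 + 1)) = 1 := by decide
        rw [this]
        rfl
    have h := orderOf_dvd_natCard (⟨_, hfix⟩ : fixingSubgroup H (Set.range x))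
    rwa [this] at h
  have c2 := t2.card_eq x
  have c4 := t4.card_eq (lastPoints 4 (by simp))
  norm_num [Nat.factorial] at c2 c4
  omega

theorem card_ne_of_sylow (h11 : MeetsConjClass H cyclePerm11) : Nat.card H ≠ 47520 := by
  intro hcard
  obtain ⟨g, hg, e, he⟩ := h11
  have hpow := pow_apply_of_conj he
  have : Fact (Nat.Prime 11) := ⟨by norm_num⟩
  have hord : orderOf (⟨g, hg⟩ : H) = 11 := by
    rw [Subgroup.orderOf_mk]
    apply orderOf_eq_prime
    · ext i
      obtain ⟨j, rfl⟩ := e.surjective i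
      rw [hpow]
      have : cyclePerm11 ^ 11 = 1 := by decide
      rw [this]
      rfl
    · intro h
      have := he 0
      rw [h, Equiv.Perm.one_apply] at this
      exact absurd (e.injective this) (by decide)
  have hZ : Nat.card (Subgroup.zpowers (⟨g, hg⟩ : H)) = 11 ^ (Nat.card H).factorization 11 := by
    rw [Nat.card_zpowers, hord, hcard]
    have : (47520 : ℕ) = 11 * 4320 := by norm_num
    rw [this, Nat.factorization_mul (by norm_num) (by norm_num)]
    rw [Finsupp.add_apply, (by norm_num : Nat.Prime 11).factorization_self,
      Nat.factorization_eq_zero_of_not_dvd (by norm_num), add_zero, pow_one]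
  let P : Sylow 11 H := Sylow.ofCard _ hZ
  have hcN := (Subgroup.normalizer (P : Set H)).index_mul_card
  have hsyl := card_sylow_modEq_one 11 H
  rw [P.card_eq_index_normalizer] at hsyl
  have hcyc : IsCyclic (P : Subgroup H) :=
    inferInstanceAs (IsCyclic (Subgroup.zpowers (⟨g, hg⟩ : H)))
  have hcP : Nat.card (P : Subgroup H) = 11 := by
    have : Nat.card (Subgroup.zpowers (⟨g, hg⟩ : H)) = 11 := by rw [Nat.card_zpowers, hord]
    exact this
  have haut : Nat.card (MulAut (P : Subgroup H)) = 10 := by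
    rw [IsCyclic.card_mulAut, hcP, Nat.totient_prime (by norm_num)]
  let φ := (P : Subgroup H).normalizerMonoidHom
  have hmul := φ.ker.card_eq_card_quotient_mul_card_subgroup
  have hran : Nat.card (Subgroup.normalizer ((P : Subgroup H) : Set H) ⧸ φ.ker) ∣ 10 := by
    rw [← haut, Nat.card_congr (QuotientGroup.quotientKerEquivRange φ).toEquiv]
    exact Subgroup.card_subgroup_dvd_card _
  have hker : Nat.card φ.ker = 11 := by
    have hmem : ∀ n : Subgroup.normalizer ((P : Subgroup H) : Set H), n ∈ φ.ker ↔
        ∀ h ∈ Subgroup.zpowers (⟨g, hg⟩ : H), h * n = n * h := by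
      intro n
      rw [Subgroup.normalizerMonoidHom_ker, Subgroup.mem_subgroupOf,
        Subgroup.mem_centralizer_iff]
      rfl
    have hgN : (⟨g, hg⟩ : H) ∈ Subgroup.normalizer ((P : Subgroup H) : Set H) :=
      Subgroup.le_normalizer (Subgroup.mem_zpowers (⟨g, hg⟩ : H))
    have hgK : (⟨_, hgN⟩ : Subgroup.normalizer ((P : Subgroup H) : Set H)) ∈ φ.ker := by
      rw [hmem]
      rintro _ ⟨k, rfl⟩
      exact ((Commute.refl _).zpow_left k).eq
    have hdvd : 11 ∣ Nat.card φ.ker := by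
      have := orderOf_dvd_natCard (⟨_, hgK⟩ : φ.ker)
      rwa [Subgroup.orderOf_mk, Subgroup.orderOf_mk, hord] at this
    have hle : Nat.card φ.ker ≤ Nat.card (Fin 12) := by
      refine Nat.card_le_card_of_injective
        (fun n : φ.ker => ((n : Subgroup.normalizer ((P : Subgroup H) : Set H)) : H).1 (e 0)) ?_
      intro a b hab
      simp only at hab
      have hcomm : ∀ n : φ.ker, ∀ x, (n.1.1.1) (g x) = g (n.1.1.1 x) := by
        intro n x
        have := (hmem n.1).1 n.2 _ (Subgroup.mem_zpowers _)
        exact (Equiv.congr_fun (congrArg Subtype.val this) x).symm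
      have step : ∀ i, a.1.1.1 (e i) = b.1.1.1 (e i) →
          a.1.1.1 (e (cyclePerm11 i)) = b.1.1.1 (e (cyclePerm11 i)) := by
        intro i hi
        rw [← he, hcomm, hcomm, hi]
      have hall : ∀ i : Fin 12, i ≠ 11 → a.1.1.1 (e i) = b.1.1.1 (e i) := by
        have h1 := step 0 hab
        have h2 := step 1 h1
        have h3 := step 2 h2
        have h4 := step 3 h3
        have h5 := step 4 h4
        have h6 := step 5 h5
        have h7 := step 6 h6
        have h8 := step 7 h7
        have h9 := step 8 h8
        have h10 := step 9 h9
        intro i hi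
        fin_cases i
        exacts [hab, h1, h2, h3, h4, h5, h6, h7, h8, h9, h10, absurd rfl hi]
      have hlast : a.1.1.1 (e 11) = b.1.1.1 (e 11) := by
        obtain ⟨j, hj⟩ := (e.trans b.1.1.1).surjective (a.1.1.1 (e 11))
        by_cases hj' : j = 11
        · rw [← hj, hj']
          rfl
        · have h1 : a.1.1.1 (e j) = a.1.1.1 (e 11) := (hall j hj').trans hj
          exact absurd (e.injective (a.1.1.1.injective h1)) hj'
      apply Subtype.ext
      apply Subtype.ext
      apply Subtype.ext
      ext x
      obtain ⟨i, rfl⟩ := e.surjective x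
      by_cases hi : i = 11
      · rw [hi, hlast]
      · rw [hall i hi]
    rw [Nat.card_eq_fintype_card (α := Fin 12), Fintype.card_fin] at hle
    have := Nat.card_pos (α := φ.ker)
    omega
  have hN : Nat.card (Subgroup.normalizer (P : Set H)) =
      Nat.card (Subgroup.normalizer ((P : Subgroup H) : Set H) ⧸ φ.ker) * 11 :=
    hmul.trans (congrArg _ hker)
  have hd : Nat.card (Subgroup.normalizer ((P : Subgroup H) : Set H) ⧸ φ.ker) ∈ Nat.divisors 10 :=
    Nat.mem_divisors.2 ⟨hran, by norm_num⟩
  have hdiv : Nat.divisors 10 = {1, 2, 5, 10} := by decide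
  rw [hdiv] at hd
  simp only [Finset.mem_insert, Finset.mem_singleton] at hd
  rw [hN, hcard] at hcN
  unfold Nat.ModEq at hsyl
  rcases hd with hd | hd | hd | hd <;> rw [hd] at hcN <;> omega

theorem card_eq_of_cycleTypes (h11 : MeetsConjClass H cyclePerm11)
    (h10 : MeetsConjClass H cyclePerm10) (h8 : MeetsConjClass H cyclePerm8)
    (h6 : MeetsConjClass H cyclePerm6) (hle : Nat.card H ≤ 95040) : Nat.card H = 95040 := by
  have t4 := transitiveOnTuples_four h11 h10 h8 h6
  obtain ⟨k, hk⟩ := dvd_card_of_fourfold h8 ((t4.of_succ (by simp)).of_succ (by simp)) t4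
  have h1 := card_ne_of_sylow h11
  have h2 : 0 < Nat.card H := Nat.card_pos
  have : k = 2 := by
    have : k ≠ 1 := by rintro rfl; exact h1 hk
    omega
  rw [hk, this]

end

/-! ### The automorphism group of a Hadamard matrix of order twelve -/

/-- A Hadamard matrix of order twelve, with `true` standing for the entry `-1`. -/
def hadamard (i j : Fin 12) : Bool :=
  Nat.testBit (![0, 1686, 2358, 3150, 3536, 3640, 1892, 2786, 252, 1450, 858, 2956] i) j

/-- The parity of the minor of `hadamard` in rows `i`, `i'` and columns `j`, `j'`. -/
def hadamardMinor (i i' j j' : Fin 12) : Bool :=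
  ((hadamard i j).xor (hadamard i' j')).xor ((hadamard i j').xor (hadamard i' j))

/-- `H` permutes the rows of `hadamard`, preserving minors for suitable column permutations. -/
def PreservesHadamard (H : Subgroup (Equiv.Perm (Fin 12))) : Prop :=
  ∀ π ∈ H, ∃ ρ : Fin 12 → Fin 12, Function.Injective ρ ∧
    ∀ i i' j j', hadamardMinor (π i) (π i') (ρ j) (ρ j') = hadamardMinor i i' j j'

theorem eq_of_preserves_hadamardMinor {π ρ : Fin 12 → Fin 12} (hρ : Function.Injective ρ)
    (h : ∀ i i' j j', hadamardMinor (π i) (π i') (ρ j) (ρ j') = hadamardMinor i i' j j')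
    (hπ : ∀ i, i < 5 → π i = i) (i : Fin 12) : π i = i := by
  have htwin : ∀ i i', i < 5 → i' < 5 → hadamardMinor i i' (ρ 1) (ρ 2) = false := by
    intro i i' hi hi'
    have := h i i' 1 2
    rw [hπ i hi, hπ i' hi'] at this
    rw [this]
    clear this
    revert i i'
    decide +kernel
  have hpair : ∀ a b : Fin 12, a ≠ b →
      (∀ i i', i < 5 → i' < 5 → hadamardMinor i i' a b = false) →
      a = 1 ∨ a = 2 := by
    decide +kernel
  have hcol : ∀ j, j ≠ 1 → j ≠ 2 → ρ j = j := by
    intro j h1 h2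
    have hj : ∀ i i', i < 5 → i' < 5 → hadamardMinor i i' (ρ j) (ρ 1) = hadamardMinor i i' j 1 := by
      intro i i' hi hi'
      have := h i i' j 1
      rwa [hπ i hi, hπ i' hi'] at this
    have h3 := hpair (ρ 1) (ρ 2) (fun e => absurd (hρ e) (by decide)) htwin
    have key : ∀ j, j ≠ 1 → j ≠ 2 → ∀ k, ∀ t, (t = 1 ∨ t = 2) →
        (∀ i i', i < 5 → i' < 5 → hadamardMinor i i' k t = hadamardMinor i i' j 1) → k = j := by
      decide +kernel
    exact key j h1 h2 _ _ h3 hj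
  have key : ∀ i k : Fin 12, (∀ j j', j ≠ 1 → j ≠ 2 → j' ≠ 1 → j' ≠ 2 →
      hadamardMinor k 0 j j' = hadamardMinor i 0 j j') → k = i := by
    decide +kernel
  refine key i (π i) fun j j' h1 h2 h3 h4 => ?_
  have := h i 0 j j'
  rwa [hπ 0 (by decide), hcol j h1 h2, hcol j' h3 h4] at this

theorem PreservesHadamard.card_le {H : Subgroup (Equiv.Perm (Fin 12))}
    (hH : PreservesHadamard H) : Nat.card H ≤ 95040 := by
  have hcard : Nat.card (Fin 5 ↪ Fin 12) = 95040 := by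
    rw [Nat.card_eq_fintype_card, Fintype.card_embedding_eq]
    rfl
  rw [← hcard]
  refine Nat.card_le_card_of_injective
    (fun π : H => (Fin.castLEEmb (by simp : 5 ≤ 12)).trans π.1.toEmbedding) ?_
  intro a b hab
  obtain ⟨ρ, hρ, h⟩ := hH (b⁻¹ * a : H) (b⁻¹ * a).2
  have hfix : ∀ i : Fin 12, i < 5 → (b⁻¹ * a : H).1 i = i := by
    intro i hi
    have := DFunLike.congr_fun hab ⟨i, hi⟩
    change a.1 i = b.1 i at this
    change b.1⁻¹ (a.1 i) = i
    rw [this, Equiv.Perm.inv_eq_iff_eq]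
  have : b⁻¹ * a = 1 := Subtype.ext (Equiv.ext (eq_of_preserves_hadamardMinor hρ h hfix))
  exact (inv_mul_eq_one.1 this).symm

/-! ### Computing with nested lists of coefficients -/

/-- Ring operations on a type of codes for ring elements. -/
structure CodeOps (α : Type) where
  zero : α
  add : α → α → α
  mul : α → α → α
  neg : α → α
  ofInt : ℤ → α

/-- Coefficientwise sum of two lists. -/
def listAdd {α : Type} (o : CodeOps α) : List α → List α → List α
  | [], q => q
  | a :: p, [] => a :: p
  | a :: p, b :: q => o.add a b :: listAdd o p q

/-- Product of two lists of coefficients, lowest degree first. -/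
def listMul {α : Type} (o : CodeOps α) : List α → List α → List α
  | [], _ => []
  | a :: p, q => listAdd o (q.map (o.mul a)) (o.zero :: listMul o p q)

/-- The operations on polynomials given by their lists of coefficients. -/
def CodeOps.list {α : Type} (o : CodeOps α) : CodeOps (List α) where
  zero := []
  add := listAdd o
  mul := listMul o
  neg := List.map o.neg
  ofInt n := [o.ofInt n]

/-- `f` interprets the codes of `o` as elements of a ring. -/
structure CodeOps.Interprets {α : Type} (o : CodeOps α) {B : Type*} [CommRing B] (f : α → B) :
    Prop where
  zero : f o.zero = 0
  add : ∀ a b, f (o.add a b) = f a + f b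
  mul : ∀ a b, f (o.mul a b) = f a * f b
  neg : ∀ a, f (o.neg a) = -f a
  ofInt : ∀ n : ℤ, f (o.ofInt n) = n

/-- The value at `x` of the polynomial with coefficient list `l`. -/
def listEval {α : Type} {B : Type*} [CommRing B] (f : α → B) (x : B) : List α → B
  | [] => 0
  | a :: l => f a + x * listEval f x l

section listEval

variable {α : Type} {o : CodeOps α} {B : Type*} [CommRing B] {f : α → B}

theorem listEval_add (hf : o.Interprets f) (x : B) : ∀ p q,
    listEval f x (listAdd o p q) = listEval f x p + listEval f x q
  | [], q => by simp [listAdd, listEval]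
  | a :: p, [] => by simp [listAdd, listEval]
  | a :: p, b :: q => by
    simp only [listAdd, listEval, hf.add, listEval_add hf x p q]
    ring

theorem listEval_map_mul (hf : o.Interprets f) (x : B) (a : α) : ∀ q,
    listEval f x (q.map (o.mul a)) = f a * listEval f x q
  | [] => by simp [listEval]
  | b :: q => by
    simp only [List.map_cons, listEval, hf.mul, listEval_map_mul hf x a q]
    ring

theorem listEval_mul (hf : o.Interprets f) (x : B) : ∀ p q,
    listEval f x (listMul o p q) = listEval f x p * listEval f x q
  | [], q => by simp [listMul, listEval]
  | a :: p, q => by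
    simp only [listMul, listEval, listEval_add hf, listEval_map_mul hf, listEval_mul hf x p q,
      hf.zero]
    ring

theorem listEval_neg (hf : o.Interprets f) (x : B) : ∀ q,
    listEval f x (q.map o.neg) = -listEval f x q
  | [] => by simp [listEval]
  | b :: q => by
    simp only [List.map_cons, listEval, hf.neg, listEval_neg hf x q]
    ring

theorem CodeOps.Interprets.list (hf : o.Interprets f) (x : B) :
    o.list.Interprets (listEval f x) where
  zero := rfl
  add := listEval_add hf x
  mul := listEval_mul hf x
  neg := listEval_neg hf x
  ofInt n := by simp [CodeOps.list, listEval, hf.ofInt]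

theorem listEval_append_singleton (x : B) (a : α) : ∀ l : List α,
    listEval f x (l ++ [a]) = listEval f x l + x ^ l.length * f a
  | [] => by simp [listEval]
  | b :: l => by
    simp only [List.cons_append, listEval, listEval_append_singleton x a l, List.length_cons]
    ring

theorem listEval_reverse {x y : B} (hxy : x * y = 1) : ∀ l : List α,
    listEval f y l.reverse * x ^ l.length = x * listEval f x l
  | [] => by simp [listEval]
  | a :: l => by
    have h : x ^ l.length * y ^ l.length = 1 := by rw [← mul_pow, hxy, one_pow]
    simp only [List.reverse_cons, listEval, listEval_append_singleton, List.length_reverse,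
      List.length_cons]
    linear_combination x * listEval_reverse hxy l + x * f a * h

theorem map_listEval {B' : Type*} [CommRing B'] (φ : B →+* B') (x : B) : ∀ l : List α,
    φ (listEval f x l) = listEval (fun a => φ (f a)) (φ x) l
  | [] => by simp [listEval]
  | a :: l => by simp [listEval, map_listEval φ x l]

theorem listEval_eq_zero {x : B} : ∀ {l : List α}, (∀ a ∈ l, f a = 0) → listEval f x l = 0
  | [], _ => rfl
  | a :: l, h => by
    rw [listEval, h a (by simp), listEval_eq_zero fun b hb => h b (by simp [hb])]
    simp

/-- Cancels the constant term of `a` against that of the list `h :: t`, and divides by the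
variable. -/
def listCancel (o : CodeOps α) (h : α) (t : List α) : List α → List α
  | [] => []
  | a :: l => listAdd o (l.map (o.mul h)) (t.map (o.mul (o.neg a)))

theorem listEval_eq_zero_of_listCancel [IsDomain B] (hf : o.Interprets f) {x : B} {h : α}
    {t : List α} (ht : listEval f x (h :: t) = 0) (hh : f h ≠ 0) {l : List α}
    (hl : listEval f x (listCancel o h t l) = 0) : listEval f x l = 0 := by
  cases l with
  | nil => rfl
  | cons a l =>
    simp only [listCancel, listEval_add hf, listEval_map_mul hf, hf.neg] at hl
    refine (mul_eq_zero.1 ?_).resolve_left hh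
    simp only [listEval] at ht ⊢
    linear_combination x * hl + f a * ht

theorem listEval_eq_zero_of_iterate_listCancel [IsDomain B] (hf : o.Interprets f) {x : B} {h : α}
    {t : List α} (ht : listEval f x (h :: t) = 0) (hh : f h ≠ 0) (n : ℕ) : ∀ {l : List α},
    listEval f x ((listCancel o h t)^[n] l) = 0 → listEval f x l = 0 := by
  induction n with
  | zero => exact id
  | succ n ih => exact fun hl => listEval_eq_zero_of_listCancel hf ht hh (ih hl)

end listEval

/-- The element `a + bθ + cθ² + dθ³`. -/
def quarticEval {α : Type} {B : Type*} [CommRing B] (f : α → B) (θ : B) (a : α × α × α × α) : B :=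
  f a.1 + θ * (f a.2.1 + θ * (f a.2.2.1 + θ * f a.2.2.2))

/-- The arithmetic of elements `a + bθ + cθ² + dθ³`, where `θ⁴ = 10θ² - 45`. -/
def CodeOps.quartic {α : Type} (o : CodeOps α) : CodeOps (α × α × α × α) where
  zero := (o.zero, o.zero, o.zero, o.zero)
  add a b := (o.add a.1 b.1, o.add a.2.1 b.2.1, o.add a.2.2.1 b.2.2.1, o.add a.2.2.2 b.2.2.2)
  mul
    | (a0, a1, a2, a3), (b0, b1, b2, b3) =>
      (o.add (o.mul a0 b0) (o.mul (o.ofInt (-45)) (o.add (o.add (o.mul a1 b3) (o.mul a2 b2))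
          (o.add (o.mul a3 b1) (o.mul (o.ofInt 10) (o.mul a3 b3))))),
        o.add (o.add (o.mul a0 b1) (o.mul a1 b0))
          (o.mul (o.ofInt (-45)) (o.add (o.mul a2 b3) (o.mul a3 b2))),
        o.add (o.add (o.add (o.mul a0 b2) (o.mul a1 b1)) (o.mul a2 b0))
          (o.add (o.mul (o.ofInt 10) (o.add (o.add (o.mul a1 b3) (o.mul a2 b2)) (o.mul a3 b1)))
            (o.mul (o.ofInt 55) (o.mul a3 b3))),
        o.add (o.add (o.add (o.mul a0 b3) (o.mul a1 b2)) (o.add (o.mul a2 b1) (o.mul a3 b0)))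
          (o.mul (o.ofInt 10) (o.add (o.mul a2 b3) (o.mul a3 b2))))
  neg a := (o.neg a.1, o.neg a.2.1, o.neg a.2.2.1, o.neg a.2.2.2)
  ofInt n := (o.ofInt n, o.zero, o.zero, o.zero)

theorem CodeOps.Interprets.quartic {α : Type} {o : CodeOps α} {B : Type*} [CommRing B] {f : α → B}
    (hf : o.Interprets f) {θ : B} (hθ : θ ^ 4 = 10 * θ ^ 2 - 45) :
    o.quartic.Interprets (quarticEval f θ) where
  zero := by simp [CodeOps.quartic, quarticEval, hf.zero]
  add a b := by
    simp only [CodeOps.quartic, quarticEval, hf.add]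
    ring
  mul a b := by
    obtain ⟨a0, a1, a2, a3⟩ := a
    obtain ⟨b0, b1, b2, b3⟩ := b
    simp only [CodeOps.quartic, quarticEval, hf.add, hf.mul, hf.ofInt]
    push_cast
    linear_combination (-(f a1 * f b3 + f a2 * f b2 + f a3 * f b1) -
      θ * (f a2 * f b3 + f a3 * f b2) - (θ ^ 2 + 10) * (f a3 * f b3)) * hθ
  neg a := by
    simp only [CodeOps.quartic, quarticEval, hf.neg]
    ring
  ofInt n := by simp [CodeOps.quartic, quarticEval, hf.ofInt, hf.zero]

/-- The base used to encode polynomials with natural coefficients. -/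
def packBase : ℕ := 2 ^ 1500

/-- A difference of two polynomials with natural coefficients, recorded by their values at
`packBase` and a bound for their values at one. -/
structure PackedPoly where
  posVal : ℕ
  negVal : ℕ
  bound : ℕ
  pos : ℕ[X]
  neg : ℕ[X]
  eval_pos : pos.eval packBase = posVal
  eval_neg : neg.eval packBase = negVal
  eval_one : pos.eval 1 + neg.eval 1 ≤ bound

namespace PackedPoly

/-- The monomial of degree one. -/
noncomputable def indet : PackedPoly := ⟨packBase, 0, 1, X, 0, by simp, by simp, by simp⟩

/-- The arithmetic of packed polynomials. -/
noncomputable def ops : CodeOps PackedPoly where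
  zero := ⟨0, 0, 0, 0, 0, by simp, by simp, by simp⟩
  add a b := ⟨a.posVal + b.posVal, a.negVal + b.negVal, a.bound + b.bound, a.pos + b.pos,
    a.neg + b.neg, by simp [a.eval_pos, b.eval_pos], by simp [a.eval_neg, b.eval_neg], by
      have := a.eval_one
      have := b.eval_one
      simp only [eval_add]
      omega⟩
  mul a b := ⟨a.posVal * b.posVal + a.negVal * b.negVal, a.posVal * b.negVal + a.negVal * b.posVal,
    a.bound * b.bound, a.pos * b.pos + a.neg * b.neg, a.pos * b.neg + a.neg * b.pos,
    by simp [a.eval_pos, b.eval_pos, a.eval_neg, b.eval_neg],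
    by simp [a.eval_pos, b.eval_pos, a.eval_neg, b.eval_neg], by
      have := Nat.mul_le_mul a.eval_one b.eval_one
      simp only [eval_add, eval_mul]
      linarith⟩
  neg a := ⟨a.negVal, a.posVal, a.bound, a.neg, a.pos, a.eval_neg, a.eval_pos, by
    rw [add_comm]
    exact a.eval_one⟩
  ofInt n := ⟨n.toNat, (-n).toNat, n.natAbs, C n.toNat, C (-n).toNat, by simp, by simp, by
    simp only [eval_C]
    omega⟩

/-- The value of a packed polynomial. -/
noncomputable def value {B : Type*} [CommRing B] (v : B) (a : PackedPoly) : B :=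
  eval₂ (Nat.castRingHom B) v a.pos - eval₂ (Nat.castRingHom B) v a.neg

theorem ops_interprets {B : Type*} [CommRing B] (v : B) : ops.Interprets (value v) where
  zero := by simp [ops, value]
  add a b := by
    simp only [ops, value, eval₂_add]
    ring
  mul a b := by
    simp only [ops, value, eval₂_add, eval₂_mul]
    ring
  neg a := by simp [ops, value]
  ofInt n := by
    have h : (n.toNat : ℤ) - (-n).toNat = n := by omega
    have h2 := congrArg (Int.cast : ℤ → B) h
    rw [Int.cast_sub, Int.cast_natCast, Int.cast_natCast] at h2
    simpa [ops, value] using h2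

theorem value_indet {B : Type*} [CommRing B] (v : B) : value v indet = v := by
  simp [value, indet]

theorem eq_of_eval_eq {M : ℕ} (n : ℕ) : ∀ {p q : ℕ[X]}, p.natDegree ≤ n → q.natDegree ≤ n →
    p.eval 1 < M → q.eval 1 < M → p.eval M = q.eval M → p = q := by
  have key : ∀ (p : ℕ[X]) (x : ℕ), p.eval x = p.divX.eval x * x + p.coeff 0 := fun p x => by
    conv_lhs => rw [← p.divX_mul_X_add]
    simp
  induction n with
  | zero =>
    intro p q hp hq _ _ h
    rw [eq_C_of_natDegree_le_zero hp, eq_C_of_natDegree_le_zero hq] at h ⊢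
    simpa using h
  | succ n ih =>
    intro p q hp hq hp1 hq1 h
    rw [key p, key q] at h
    have hp1' := key p 1
    have hq1' := key q 1
    rw [mul_one] at hp1' hq1'
    have h0 : p.coeff 0 = q.coeff 0 := by
      have := congrArg (· % M) h
      simpa [Nat.add_mod, Nat.mod_eq_of_lt (show p.coeff 0 < M by omega),
        Nat.mod_eq_of_lt (show q.coeff 0 < M by omega)] using this
    have hX : p.divX = q.divX := by
      refine ih ?_ ?_ (by omega) (by omega) ?_
      · rw [natDegree_divX_eq_natDegree_tsub_one]
        omega
      · rw [natDegree_divX_eq_natDegree_tsub_one]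
        omega
      · rw [h0] at h
        exact Nat.eq_of_mul_eq_mul_right (by omega : 0 < M) (by omega)
    rw [← p.divX_mul_X_add, ← q.divX_mul_X_add, hX, h0]

/-- A test for the vanishing of a packed polynomial. -/
def isZero (a : PackedPoly) : Bool := Nat.beq a.posVal a.negVal && Nat.blt a.bound packBase

theorem value_eq_zero {B : Type*} [CommRing B] (v : B) {a : PackedPoly} (ha : a.isZero = true) :
    a.value v = 0 := by
  simp only [isZero, Bool.and_eq_true] at ha
  have h1 := Nat.eq_of_beq_eq_true ha.1
  have h2 : a.bound < packBase := by simpa using ha.2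
  have h3 := a.eval_one
  have : a.pos = a.neg := eq_of_eval_eq (max a.pos.natDegree a.neg.natDegree) (le_max_left _ _)
    (le_max_right _ _) (M := packBase) (by omega) (by omega) (by rw [a.eval_pos, a.eval_neg, h1])
  rw [value, this, sub_self]

/-- The packed polynomial with the given coefficients. -/
noncomputable def ofList : List ℤ → PackedPoly
  | [] => ops.zero
  | n :: l => ops.add (ops.ofInt n) (ops.mul indet (ofList l))

theorem value_ofList {B : Type*} [CommRing B] (v : B) : ∀ l : List ℤ,
    value v (ofList l) = listEval (Int.cast : ℤ → B) v l
  | [] => (ops_interprets v).zero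
  | n :: l => by
    simp only [ofList, (ops_interprets v).add, (ops_interprets v).mul, (ops_interprets v).ofInt,
      listEval, value_indet, value_ofList v l]

end PackedPoly

/-- Codes for polynomials in `v` over `ℤ[θ]`. -/
noncomputable def polyOps : CodeOps (PackedPoly × PackedPoly × PackedPoly × PackedPoly) :=
  PackedPoly.ops.quartic

/-- Codes for polynomials in `u` and `v` over `ℤ[θ]`. -/
noncomputable def bipolyOps :
    CodeOps (List (PackedPoly × PackedPoly × PackedPoly × PackedPoly)) :=
  polyOps.list

/-- The value of a polynomial in `u` and `v` over `ℤ[θ]`. -/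
noncomputable def bipolyEval {B : Type*} [CommRing B] (θ u v : B)
    (l : List (PackedPoly × PackedPoly × PackedPoly × PackedPoly)) : B :=
  listEval (quarticEval (PackedPoly.value v) θ) u l

theorem bipolyOps_interprets {B : Type*} [CommRing B] {θ : B} (hθ : θ ^ 4 = 10 * θ ^ 2 - 45)
    (u v : B) : bipolyOps.Interprets (bipolyEval θ u v) :=
  ((PackedPoly.ops_interprets v).quartic hθ).list u

/-! ### The two coverings and the incidence form -/

/-- The coefficients of the polynomial with roots `u` at `s = 0`. -/
def coverCoeffs0 : List ℤ :=
  [35283600000000, 6998400000000, -2566080000000, 0, 57348000000, 0, -400680000, 0, 1242000, 0,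
   -1800, 0, 1]

/-- The coefficients of the linear term in `s` of the polynomial with roots `u`. -/
def coverCoeffs1 : List ℤ :=
  [32076000000000, 1539648000000, -1166400000000, -55987200000, 4860000000, 233280000, -5400000,
   -259200]

/-- The coefficients of the quadratic term in `s` of the polynomial with roots `u`. -/
def coverCoeffs2 : List ℤ := [7290000000000, -699840000000, 16796160000]

/-- The coefficients of the polynomial with roots `v` at `s = 0`. The other term is a multiple of
`s * v ^ 2`. -/
def twinCoeffs : List ℤ :=
  [332150625, 1328602500, -319848750, 1131772500, 100875375, -107163000, -10570500, 3645000,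
   888975, 83700, 4050, 100, 1]

/-- The coefficients of the denominator of the quadratic irrationality `z`. -/
def denomCoeffs : List ℤ := [-3600, 5400, -60, -30, 1]

/-- The coefficients of the cofactor of `6 * u + 125` in the numerator of `z`. -/
def numerCoeffs : List ℤ := [-5940000, 0, 216000, 0, -900, 0, 1]

/-- The coefficients of `z ^ 2` as a polynomial in `u`. -/
def squareCoeffs : List ℤ := [0, -270000000, 0, 3060000, 180000, 3000]

/-- The coefficients of the quartic in `v` whose sixth power divides the norm of the incidence
form. -/
def quarticCoeffs : List ℤ := [-405, -270, 180, 30, 1]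

/-- The part free of `z` of the factor in `u` of the squared incidence form. -/
def firstFactorCoeffs : List (List ℤ × List ℤ × List ℤ × List ℤ) :=
  [([1912500], [-1125000], [62500], [50000]),
   ([67500], [-2250], [-3000], [1350]),
   ([-2250], [2700], [0], [-180])]

/-- The factor in `v` of the squared incidence form. -/
def secondFactorCoeffs : List ℤ × List ℤ × List ℤ × List ℤ :=
  ([0, 2025, 0, 390, 40, 1], [0, -1350, 720, 130, 4], [0, -1800, 120, 8], [0, -450, -60, -2])

/-- The part of the incidence form that is even in `z`. -/
def evenCoeffs : List (List ℤ × List ℤ × List ℤ × List ℤ) :=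
  [([6272882526972656250, 35395457804423437500, 71215828596095625000, 61759475889274687500,
     8971616801234812500, -23632551966354187500, -16208050253708250000, -1964139056856562500,
     991486488876750000, 225891081944437500, -17805812880375000, -11817910298137500,
     -1875542949562500, -160525544062500, -8304870600000, -260273587500, -4563056250, -34425000],
    [5102802026666015625, 25634535969870703125, 48776830112303718750, 42956348411675531250,
     15311401169834531250, -1027832218639875000, -949617646369031250, 333455408021868750,
     42816743871187500, -20071581930281250, -2187793783293750, 710877988968750, 190987762968750,
     20627551575000, 1235889406250, 43011431250, 816496875, 6558125],
    [-10593528996093750, -263255111985937500, -977005917369000000, -951524749666687500,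
     748598041292062500, 2020276485987187500, 1454924754014175000, 285086001591562500,
     -85040187720750000, -24123261729037500, 1450631093850000, 1194168771337500, 194250259087500,
     16724594662500, 864414975000, 26977387500, 470253750, 3525000],
    [-570284977623046875, -2501167570019296875, -3808908544550906250, -2080985030452968750,
     146876428801968750, 454873944979800000, -80784720592031250, -109502987634731250,
     1064832202575000, 6264567466593750, 583482890981250, -121585894931250, -32363569188750,
     -3342591000000, -192358043750, -6471408750, -119428125, -936875]),
   ([-301098361294687500, -3163745664095625000, -2058504959900250000, 966989782411875000,
     -2951241141490875000, -2334209991832575000, 492907825127700000, 120017821263075000,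
     -44502629863500000, -10883960657865000, 836858108790000, 566399756385000, 90012948327000,
     7705226115000, 398633788800, 12493132200, 219026700, 1652400],
    [-244934497279968750, -1602742868875968750, 2282906021795437500, 4714322134943812500,
     -1009717849173937500, 159801800593725000, 97653340973137500, -16119700970962500,
     -2941711994025000, 802087201732500, 88644100612500, -35059255312500, -9195409145700,
     -990459750600, -59322691500, -2064548700, -39191850, -314790],
    [508489391812500, 136671545561625000, 764091255172500000, 392757817393125000,
     116322598812825000, 315902606205375000, -40594478031450000, -15720153080355000,
     4079245165020000, 1205685808785000, -64919332440000, -57137713497000, -9321454542600,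
     -802780543800, -41491918800, -1294914600, -22572180, -169200],
    [27373678925906250, 153789343209281250, -225834158981812500, -479559118876087500,
     198815516966137500, -49447761031575000, -4550867998942500, 5028106576837500, 73596829230000,
     -271078951927500, -24781513045500, 6023415811500, 1559050625700, 160511823000, 9233186100,
     310627620, 5732550, 44970]),
   ([0, -43018023186000000, -1118731666131000000, -3789104604940800000, 495785666716200000,
     624649704782400000, 72368730169200000, 3289795624800000, 422508979440000, 46630724112000,
     2357471304000, 58281120000, 582811200],
    [0, -21509011593000000, -1109115108375750000, -1048674719074050000, 118421845383150000,
     -34049854943550000, -10572739065180000, 251708872140000, 138497796540000, 16363881468000,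
     1275142338000, 60337148400, 1537974000, 16189200],
    [0, 2389890177000000, -42998359869000000, 303302602153800000, -8645777433000000,
     -77970489924240000, -9153843689520000, -395458413840000, -46595755440000, -5393917656000,
     -282663432000, -6928977600, -64756800],
    [0, 2389890177000000, 106280095524750000, 25741528767450000, -41942395459350000,
     9271983614310000, 1993223270700000, 11342962980000, -19167203340000, -2883458412000,
     -245703488400, -11963818800, -307594800, -3237840]),
   ([0, 0, -98678390032800000, -88571870247600000, 26962977999600000, 64962842380560000,
     8276196040560000, 252513364464000, 1940761296000, 157359024000, 3496867200],
    [0, 0, -110804332473900000, -142663405547700000, 10123266081600000, -2390659388640000,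
     -1198306026360000, -34959929832000, 2972337120000, 228461990400, 7673680800, 97135200],
    [0, 0, -9419898013200000, -5848019279280000, 1561080774960000, -8274843949680000,
     -1017319091760000, -29865543696000, 99077904000, 5051030400],
    [0, 0, 9287027134380000, 11874457474020000, -5236692068160000, 604360478880000,
     178344373752000, 4292404488000, -491892652800, -40408243200, -1457028000, -19427040]),
   ([0, 0, 1385785551600000, 36342033000480000, -951827364720000, 83396713536000, 22705993872000,
     620268192000, 3496867200],
    [0, 0, -77547870720000, -2513922207840000, -287113559040000, 11766759840000, -6312696768000,
     -832254393600, -41962406400, -777081600],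
    [0, 0, -470516603760000, -4316815723680000, 109206007920000, -60815956032000, -6360810768000,
     -233191353600, -3496867200],
    [0, 0, -124102102320000, 835678769040000, -51574183920000, -12320298288000, -239086339200,
     45459273600, 3496867200, 77708160]),
   ([0, 0, 314953194240000, 2496962075328000, -101688991488000, -138170251008000, -17353456588800,
     -535377600000],
    [0, 0, 242464641840000, 188381426544000, -41383428768000, 5059465286400, 2485558742400,
     101409148800],
    [0, 0, -7577167680000, -257116037184000, 1876131072000, 13914890726400, 1806828249600,
     54820800000],
    [0, 0, -28826304624000, 21807819216000, 10024830086400, -1760419526400, -411391612800,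
     -14686842240]),
   ([0, 0, 7049033424000, 45870522912000, -1954611129600, -3283355347200, -418245379200,
     -12849062400],
    [0, 0, 5734177531200, 5563290600000, -851369356800, 114825081600, 59975121600, 2447807040],
    [0, 0, -11904278400, -4494806380800, 2225491200, 345539001600, 43951351680, 1315699200],
    [0, 0, -640846987200, 179925364800, 268962508800, -35647983360, -9607636800, -349686720])]

/-- The part of the incidence form that is odd in `z`. -/
def oddCoeffs : List (List ℤ × List ℤ × List ℤ × List ℤ) :=
  [([0, -179241763275000, -121056945390000, 54376157385000, -118210429296000, -208800925038000,
     -11134358172000, 6751229634000, 1216909785600, 86037503400, 2787780240, 33997320],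
    [0, -65721979867500, 14310377527500, 120022456117500, -60809772289500, -4558235067000,
     1198950579000, 707459945400, 172002155400, 19735444260, 1161575100, 33727500, 377748],
    [0, 11949450885000, 51342515010000, 48231124785000, 9751115664000, 11124634770000,
     -150327381600, -636740967600, -116562240000, -9310408920, -346448880, -4856760],
    [0, 5974725442500, -7670022232500, -26070241756500, 7338363682500, 1494150964200,
     -278404662600, -211341911400, -40723932600, -3722706540, -185366340, -4910724, -53964]),
   ([0, 0, -226459764684000, -466822734516000, 77515984260000, 142143776316000, 17397478274400,
     419440356000, -8217637920, -174843360],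
    [0, 0, -235653693984000, -264636124164000, 36008473860000, -5590103220000, -2730546482400,
     -96688378080, 3438586080, 213697440, 3885408],
    [0, 0, -15375651012000, 21564930996000, 1926934207200, -17329621788000, -2151834789600,
     -60881531040, 524530080, 19427040],
    [0, 0, 21485096748000, 17536560976800, -11331849520800, 1517076410400, 450499255200,
     21156046560, 291405600, 3885408]),
   ([0, 0, -6874720776000, 35140768488000, 1141614000000, 5059948176000, 662939536320, 19980198720],
    [0, 0, -8465500836000, -12277982462400, 354509200800, -187821659520, -90297905760,
     -3613429440, 3885408],
    [0, 0, -1185609441600, -5524666430400, 197669808000, -644352485760, -75365536320, -2126658240],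
    [0, 0, 613212055200, 1707109214400, -412371972000, 34685470080, 11773991520, 349686720,
     -3885408]),
   ([0, 0, 1174838904000, 6260327740800, -361436567040, -551422131840, -69707563200, -2141510400],
    [0, 0, 955696255200, 767058582240, -173716384320, 21119071680, 10019166048, 407967840],
    [0, 0, -1984046400, -596670986880, 2469035520, 57589833600, 7325225280, 219283200],
    [0, 0, -106807831200, 26490693600, 40980530880, -6664016448, -1624585248, -58281120]),
   ([0, 0, 0, 37766165760],
    [0, 0, 0, 2098120320, 839248128],
    [0, 0, 0, -4196240640],
    [0, 0, 0, 419624064])]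

/-- The code of an element of `ℤ[θ][v]`. -/
noncomputable def packQuartic (a : List ℤ × List ℤ × List ℤ × List ℤ) :
    PackedPoly × PackedPoly × PackedPoly × PackedPoly :=
  (PackedPoly.ofList a.1, PackedPoly.ofList a.2.1, PackedPoly.ofList a.2.2.1,
    PackedPoly.ofList a.2.2.2)

/-- The code of a polynomial in `u` with integral coefficients. -/
noncomputable def polyInU (l : List ℤ) :
    List (PackedPoly × PackedPoly × PackedPoly × PackedPoly) :=
  l.map polyOps.ofInt

/-- The code of a polynomial in `v` with integral coefficients. -/
noncomputable def polyInV (l : List ℤ) :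
    List (PackedPoly × PackedPoly × PackedPoly × PackedPoly) :=
  [packQuartic (l, [], [], [])]

/-- The code of the factor of the squared incidence form that depends only on `v`. -/
noncomputable def vFactorCode : List (PackedPoly × PackedPoly × PackedPoly × PackedPoly) :=
  let q := polyInV quarticCoeffs
  let q2 := bipolyOps.mul q q
  bipolyOps.mul (bipolyOps.mul q2 (bipolyOps.mul q2 q2)) [packQuartic secondFactorCoeffs]

/-- The code of the part even in `z` of the relation for the squared incidence form. -/
noncomputable def evenRelationCode : List (PackedPoly × PackedPoly × PackedPoly × PackedPoly) :=
  let e := evenCoeffs.map packQuartic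
  let o := oddCoeffs.map packQuartic
  bipolyOps.add (bipolyOps.add (bipolyOps.mul e e)
      (bipolyOps.mul (polyInU squareCoeffs) (bipolyOps.mul o o)))
    (bipolyOps.mul (bipolyOps.mul (polyInU [1617840720000]) vFactorCode)
      (firstFactorCoeffs.map packQuartic))

/-- The code of the part odd in `z` of the relation for the squared incidence form. -/
noncomputable def oddRelationCode : List (PackedPoly × PackedPoly × PackedPoly × PackedPoly) :=
  bipolyOps.add
    (bipolyOps.mul (polyInU [2])
      (bipolyOps.mul (evenCoeffs.map packQuartic) (oddCoeffs.map packQuartic)))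
    (bipolyOps.mul (polyInU [9 * 1617840720000]) vFactorCode)

/-- The code of the relation for the squared incidence form, cleared of denominators. -/
noncomputable def relationCode : List (PackedPoly × PackedPoly × PackedPoly × PackedPoly) :=
  let w := polyInV [0, 0, 46656]
  bipolyOps.add
    (bipolyOps.mul (bipolyOps.mul w (polyInU denomCoeffs)) evenRelationCode)
    (bipolyOps.mul
      (bipolyOps.add (bipolyOps.mul (polyInU [15625, -1500, 36]) (polyInV twinCoeffs))
        (bipolyOps.neg (bipolyOps.mul w
          (bipolyOps.mul (polyInU [125, 6]) (polyInU numerCoeffs))))) oddRelationCode)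

/-- The code of the polynomial for `u` with `s` eliminated. -/
noncomputable def eliminantCode : List (PackedPoly × PackedPoly × PackedPoly × PackedPoly) :=
  let w := polyInV [0, 0, 51200 * 3 ^ 9]
  let t := polyInV twinCoeffs
  bipolyOps.add (bipolyOps.mul (bipolyOps.mul w w) (polyInU coverCoeffs0))
    (bipolyOps.add (bipolyOps.mul (bipolyOps.mul w t) (polyInU coverCoeffs1))
      (bipolyOps.mul (bipolyOps.mul t t) (polyInU coverCoeffs2)))

/-- A test for the vanishing of a polynomial in `v` over `ℤ[θ]`. -/
def quarticIsZero (a : PackedPoly × PackedPoly × PackedPoly × PackedPoly) : Bool :=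
  a.1.isZero && a.2.1.isZero && a.2.2.1.isZero && a.2.2.2.isZero

/-- The difference of the leading coefficient of `eliminantCode` and its expected value. -/
noncomputable def leadingDefect : PackedPoly × PackedPoly × PackedPoly × PackedPoly :=
  polyOps.add (eliminantCode.reverse.headD polyOps.zero)
    (polyOps.neg (packQuartic ([0, 0, 0, 0, (51200 * 3 ^ 9) ^ 2], [], [], [])))

theorem leadingDefect_isZero : quarticIsZero leadingDefect = true := by decide +kernel

/-- What the iterated cancellation by `eliminantCode` leaves of `relationCode`. -/
noncomputable def relationRemainder : List (PackedPoly × PackedPoly × PackedPoly × PackedPoly) :=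
  (listCancel polyOps (eliminantCode.reverse.headD polyOps.zero)
    eliminantCode.reverse.tail)^[6] relationCode.reverse

theorem relationRemainder_isZero : relationRemainder.all quarticIsZero = true := by
  decide +kernel

/-- The value at `x` of the polynomial with integral coefficients `l`. -/
def intEval {B : Type*} [CommRing B] (x : B) (l : List ℤ) : B := listEval Int.cast x l

/-- The value of a polynomial in `u` and `v` over `ℤ[θ]`. -/
def tripleEval {B : Type*} [CommRing B] (u v θ : B)
    (l : List (List ℤ × List ℤ × List ℤ × List ℤ)) : B :=
  listEval (quarticEval (intEval v) θ) u l

/-- The numerator of the quadratic irrationality `z`. -/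
def zNumer {B : Type*} [CommRing B] (s u : B) : B :=
  21600 * (6 * u - 125) ^ 2 * s - (6 * u + 125) * intEval u numerCoeffs

/-- The incidence form: up to squares of factors depending on only one of `u` and `v`, its values
are the entries of a Hadamard matrix. -/
def incidenceForm {B : Type*} [CommRing B] (s u v θ : B) : B :=
  intEval u denomCoeffs * tripleEval u v θ evenCoeffs + zNumer s u * tripleEval u v θ oddCoeffs

section map

variable {B B' : Type*} [CommRing B] [CommRing B'] (φ : B →+* B')

theorem map_intEval (x : B) (l : List ℤ) : φ (intEval x l) = intEval (φ x) l := by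
  simp [intEval, map_listEval]

theorem map_quarticEval {α : Type} (f : α → B) (θ : B) (a : α × α × α × α) :
    φ (quarticEval f θ a) = quarticEval (fun x => φ (f x)) (φ θ) a := by
  simp [quarticEval]

theorem map_tripleEval (u v θ : B) (l : List (List ℤ × List ℤ × List ℤ × List ℤ)) :
    φ (tripleEval u v θ l) = tripleEval (φ u) (φ v) (φ θ) l := by
  simp only [tripleEval, map_listEval, map_quarticEval, map_intEval]

theorem map_incidenceForm (s u v θ : B) :
    φ (incidenceForm s u v θ) = incidenceForm (φ s) (φ u) (φ v) (φ θ) := by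
  simp [incidenceForm, zNumer, map_intEval, map_tripleEval, map_ofNat]

end map

section relation

variable {B : Type*} [CommRing B] {s u v θ : B}

theorem bipolyEval_polyInU (l : List ℤ) : bipolyEval θ u v (polyInU l) = intEval u l := by
  induction l with
  | nil => rfl
  | cons a l ih =>
    have h := ((PackedPoly.ops_interprets v).ofInt a)
    have h0 := (PackedPoly.ops_interprets v).zero
    simp only [bipolyEval, polyInU, List.map_cons, listEval, intEval] at ih ⊢
    rw [ih]
    simp [polyOps, CodeOps.quartic, quarticEval, h, h0]

theorem quarticEval_packQuartic (a : List ℤ × List ℤ × List ℤ × List ℤ) :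
    quarticEval (PackedPoly.value v) θ (packQuartic a) = quarticEval (intEval v) θ a := by
  simp [quarticEval, packQuartic, PackedPoly.value_ofList, intEval]

theorem bipolyEval_map_packQuartic (l : List (List ℤ × List ℤ × List ℤ × List ℤ)) :
    bipolyEval θ u v (l.map packQuartic) = tripleEval u v θ l := by
  induction l with
  | nil => rfl
  | cons a l ih =>
    simp only [bipolyEval, tripleEval, List.map_cons, listEval] at ih ⊢
    rw [ih, quarticEval_packQuartic]

theorem bipolyEval_polyInV (l : List ℤ) : bipolyEval θ u v (polyInV l) = intEval v l := by
  simp [bipolyEval, polyInV, listEval, packQuartic, PackedPoly.value_ofList, quarticEval, intEval]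

/-- The factor of the squared incidence form that depends only on `v`. -/
def vFactor {B : Type*} [CommRing B] (v θ : B) : B :=
  1617840720000 * (intEval v quarticCoeffs ^ 6 * quarticEval (intEval v) θ secondFactorCoeffs)

/-- The factor of the squared incidence form that depends only on `u`. -/
def uFactor {B : Type*} [CommRing B] (s u θ : B) : B :=
  -(intEval u denomCoeffs * (intEval u denomCoeffs * tripleEval u 0 θ firstFactorCoeffs +
    9 * zNumer s u))

theorem quarticEval_eval_eq_zero {a : PackedPoly × PackedPoly × PackedPoly × PackedPoly}
    (ha : quarticIsZero a = true) :
    quarticEval (PackedPoly.value v) θ a = 0 := by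
  simp only [quarticIsZero, Bool.and_eq_true] at ha
  simp [quarticEval, PackedPoly.value_eq_zero v ha.1.1.1, PackedPoly.value_eq_zero v ha.1.1.2,
    PackedPoly.value_eq_zero v ha.1.2, PackedPoly.value_eq_zero v ha.2]

/-- `u` is a root of the first covering at the parameter `s`. -/
def IsCoverRoot {B : Type*} [CommRing B] (s u : B) : Prop :=
  intEval u coverCoeffs0 + s * intEval u coverCoeffs1 + s ^ 2 * intEval u coverCoeffs2 = 0

/-- `v` is a root of the second covering at the parameter `s`. -/
def IsTwinRoot {B : Type*} [CommRing B] (s v : B) : Prop :=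
  intEval v twinCoeffs = 51200 * 3 ^ 9 * s * v ^ 2

theorem bipolyEval_eliminantCode (hθ : θ ^ 4 = 10 * θ ^ 2 - 45) (hu : IsCoverRoot s u)
    (hv : IsTwinRoot s v) : bipolyEval θ u v eliminantCode = 0 := by
  have h := bipolyOps_interprets hθ u v
  have hw : intEval v [0, 0, 51200 * 3 ^ 9] = 51200 * 3 ^ 9 * v ^ 2 := by
    simp only [intEval, listEval]
    push_cast
    ring
  simp only [eliminantCode, h.add, h.mul, bipolyEval_polyInU, bipolyEval_polyInV, hw]
  simp only [IsCoverRoot, IsTwinRoot] at hu hv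
  rw [hv]
  linear_combination (51200 * 3 ^ 9 * v ^ 2) ^ 2 * hu

theorem zNumer_sq (hu : IsCoverRoot s u) :
    zNumer s u ^ 2 = intEval u denomCoeffs ^ 2 * intEval u squareCoeffs := by
  simp only [IsCoverRoot, zNumer, intEval, coverCoeffs0, coverCoeffs1, coverCoeffs2, denomCoeffs,
    numerCoeffs, squareCoeffs, listEval] at hu ⊢
  push_cast at hu ⊢
  linear_combination (6 * u - 125) ^ 2 * hu

theorem bipolyEval_vFactorCode (hθ : θ ^ 4 = 10 * θ ^ 2 - 45) :
    1617840720000 * bipolyEval θ u v vFactorCode = vFactor v θ := by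
  have h := bipolyOps_interprets hθ u v
  have h1 : bipolyEval θ u v [packQuartic secondFactorCoeffs] =
      quarticEval (intEval v) θ secondFactorCoeffs := by
    simp [bipolyEval, listEval, quarticEval_packQuartic]
  simp only [vFactorCode, h.mul, bipolyEval_polyInV, h1, vFactor]
  ring

theorem bipolyEval_relationCode (hθ : θ ^ 4 = 10 * θ ^ 2 - 45) (hu : IsCoverRoot s u)
    (hv : IsTwinRoot s v) : intEval u denomCoeffs * bipolyEval θ u v relationCode =
      46656 * v ^ 2 * (incidenceForm s u v θ ^ 2 - uFactor s u θ * vFactor v θ) := by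
  have h := bipolyOps_interprets hθ u v
  have hF := bipolyEval_vFactorCode (u := u) (v := v) hθ
  have hw : intEval v [0, 0, 46656] = 46656 * v ^ 2 := by
    simp only [intEval, listEval]
    push_cast
    ring
  have hq : intEval u [15625, -1500, 36] = (6 * u - 125) ^ 2 := by
    simp only [intEval, listEval]
    push_cast
    ring
  have hl : intEval u [125, 6] = 6 * u + 125 := by
    simp only [intEval, listEval]
    push_cast
    ring
  have hc : ∀ n : ℤ, intEval u [n] = n := fun n => by simp [intEval, listEval]
  have ha : tripleEval u v θ firstFactorCoeffs = tripleEval u 0 θ firstFactorCoeffs := by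
    simp [tripleEval, firstFactorCoeffs, listEval, quarticEval, intEval]
  have hz := zNumer_sq hu
  rw [IsTwinRoot] at hv
  simp only [relationCode, evenRelationCode, oddRelationCode, h.mul, h.add, h.neg,
    bipolyEval_polyInV, bipolyEval_polyInU, bipolyEval_map_packQuartic, hw, hq, hl, hc, hv, ha]
  simp only [incidenceForm, uFactor, ← hF]
  have hz' : intEval u denomCoeffs ^ 2 * intEval u squareCoeffs = zNumer s u ^ 2 := hz.symm
  generalize bipolyEval θ u v vFactorCode = F at *
  generalize tripleEval u 0 θ firstFactorCoeffs = A at *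
  generalize tripleEval u v θ evenCoeffs = N0 at *
  generalize tripleEval u v θ oddCoeffs = N1 at *
  generalize intEval u squareCoeffs = Z at *
  have hW : (6 * u - 125) ^ 2 * (51200 * 3 ^ 9 * s * v ^ 2) -
      46656 * v ^ 2 * ((6 * u + 125) * intEval u numerCoeffs) = 46656 * v ^ 2 * zNumer s u := by
    rw [zNumer]
    ring
  generalize intEval u numerCoeffs = G at *
  generalize zNumer s u = W at *
  generalize intEval u denomCoeffs = n at *
  push_cast
  linear_combination n * (2 * (N0 * N1) + 9 * 1617840720000 * F) * hW +
    46656 * v ^ 2 * N1 ^ 2 * hz'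

end relation

theorem relation_eval_eq_zero {L : Type*} [Field L] [CharZero L] {s u v θ : L}
    (hθ : θ ^ 4 = 10 * θ ^ 2 - 45) (hu : IsCoverRoot s u) (hv : IsTwinRoot s v) (hu0 : u ≠ 0)
    (hv0 : v ≠ 0) : bipolyEval θ u v relationCode = 0 := by
  have hf := (PackedPoly.ops_interprets v).quartic hθ
  have key : ∀ l, bipolyEval θ u v l = 0 ↔ bipolyEval θ u⁻¹ v l.reverse = 0 := fun l => by
    have h := listEval_reverse (f := quarticEval (PackedPoly.value v) θ) (mul_inv_cancel₀ hu0) l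
    constructor
    · intro h0
      rw [show listEval (quarticEval (PackedPoly.value v) θ) u l = 0 from h0, mul_zero] at h
      exact (mul_eq_zero.1 h).resolve_right (pow_ne_zero _ hu0)
    · intro h0
      rw [show listEval (quarticEval (PackedPoly.value v) θ) u⁻¹ l.reverse = 0 from h0,
        zero_mul] at h
      exact (mul_eq_zero.1 h.symm).resolve_left hu0
  have hE := (key _).1 (bipolyEval_eliminantCode hθ hu hv)
  have hlead := quarticEval_eval_eq_zero (v := v) (θ := θ) leadingDefect_isZero
  rw [leadingDefect, polyOps, hf.add, hf.neg, quarticEval_packQuartic] at hlead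
  have hne : quarticEval (PackedPoly.value v) θ
      (eliminantCode.reverse.headD PackedPoly.ops.quartic.zero) ≠ 0 := by
    rw [add_neg_eq_zero.1 hlead]
    simp [quarticEval, intEval, listEval, hv0]
  rw [key]
  refine listEval_eq_zero_of_iterate_listCancel hf (t := eliminantCode.reverse.tail) ?_ hne 6
    (listEval_eq_zero fun a ha => quarticEval_eval_eq_zero ?_)
  · cases h : eliminantCode.reverse with
    | nil =>
      rw [h] at hne
      exact absurd hf.zero hne
    | cons a l =>
      rw [h] at hE
      exact hE
  · exact List.all_eq_true.1 relationRemainder_isZero a ha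

theorem incidenceForm_sq {L : Type*} [Field L] [CharZero L] {s u v θ : L}
    (hθ : θ ^ 4 = 10 * θ ^ 2 - 45) (hu : IsCoverRoot s u) (hv : IsTwinRoot s v) (hu0 : u ≠ 0)
    (hv0 : v ≠ 0) : incidenceForm s u v θ ^ 2 = uFactor s u θ * vFactor v θ := by
  have h := bipolyEval_relationCode hθ hu hv
  rw [relation_eval_eq_zero hθ hu hv hu0 hv0, mul_zero] at h
  have h46 : (46656 * v ^ 2 : L) ≠ 0 := mul_ne_zero (by norm_num) (pow_ne_zero 2 hv0)
  exact sub_eq_zero.1 ((mul_eq_zero.1 h.symm).resolve_left h46)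

/-- The residues modulo 3581 of the roots `u` at the parameter 3503. -/
def coverResidues : Fin 12 → ℤ :=
  ![640, 99, 859, 1009, 1766, 2415, 3215, 714, 2564, 1622, 1031, 1971]

/-- The residues modulo 3581 of the roots `v` at the parameter 3503. -/
def twinResidues : Fin 12 → ℤ :=
  ![1809, 2094, 2148, 2988, 3201, 148, 2122, 2128, 2977, 3466, 2318, 3149]

/-- The sign of an entry of the Hadamard matrix. -/
def hadamardSign (i j : Fin 12) : ℤ := if hadamard i j then -1 else 1

/-- The residues modulo 3581 of the incidence form at `θ = t` are those of the Hadamard matrix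
with rows multiplied by `r` and columns multiplied by `c`. -/
def HasHadamardResidues (t : ℤ) (r c : Fin 12 → ℤ) : Prop := ∀ i j,
  (incidenceForm 3503 (coverResidues i) (twinResidues j) t - hadamardSign i j * (r i * c j)) %
    3581 = 0 ∧ r i % 3581 ≠ 0 ∧ c j % 3581 ≠ 0

instance (t : ℤ) (r c : Fin 12 → ℤ) : Decidable (HasHadamardResidues t r c) :=
  inferInstanceAs (Decidable (∀ _ _, _))

theorem hasHadamardResidues_75 : HasHadamardResidues 75
    ![2032, 3483, 1532, 2436, 854, 2786, 1454, 690, 1085, 2730, 3337, 1246]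
    ![1, 2569, 1439, 1063, 2809, 3395, 3091, 3012, 3232, 1981, 117, 2028] := by
  decide +kernel

theorem hasHadamardResidues_626 : HasHadamardResidues 626
    ![1835, 42, 636, 2580, 621, 2640, 1472, 591, 2137, 3532, 1729, 30]
    ![1, 384, 1960, 1520, 1882, 2900, 3524, 447, 1294, 1618, 80, 1475] := by
  decide +kernel

theorem hasHadamardResidues_2955 : HasHadamardResidues 2955
    ![3527, 3196, 2127, 3017, 800, 1569, 469, 710, 3187, 751, 320, 2576]
    ![1, 2627, 1351, 2195, 3256, 3088, 285, 3353, 434, 181, 1923, 1252] := by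
  decide +kernel

theorem hasHadamardResidues_3506 : HasHadamardResidues 3506
    ![3202, 2598, 626, 3135, 2806, 1401, 924, 1863, 1355, 875, 2924, 3368]
    ![1, 730, 3281, 2822, 2824, 101, 1239, 1935, 3316, 2543, 2784, 1179] := by
  decide +kernel

theorem exists_incidenceForm_eq {κ : Type*} [Field κ] [CharP κ 3581] {θ : κ}
    (hθ : θ ^ 4 = 10 * θ ^ 2 - 45) : ∃ r c : Fin 12 → κ, (∀ i, r i ≠ 0) ∧ (∀ j, c j ≠ 0) ∧
      ∀ i j, incidenceForm 3503 (coverResidues i : κ) (twinResidues j : κ) θ =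
        (hadamardSign i j : κ) * (r i * c j) := by
  have key : ∀ (t : ℤ) (r c : Fin 12 → ℤ), HasHadamardResidues t r c → θ = t →
      ∃ r c : Fin 12 → κ, (∀ i, r i ≠ 0) ∧ (∀ j, c j ≠ 0) ∧
        ∀ i j, incidenceForm 3503 (coverResidues i : κ) (twinResidues j : κ) θ =
          (hadamardSign i j : κ) * (r i * c j) := by
    rintro t r c h rfl
    have hcast : ∀ n : ℤ, (n : κ) = 0 ↔ n % 3581 = 0 := fun n => by
      rw [CharP.intCast_eq_zero_iff κ 3581, ← Int.dvd_iff_emod_eq_zero]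
      rfl
    refine ⟨fun i => r i, fun j => c j, fun i => ?_, fun j => ?_, fun i j => ?_⟩
    · rw [Ne, hcast]
      exact (h i 0).2.1
    · rw [Ne, hcast]
      exact (h 0 j).2.2
    · have h1 := (hcast _).2 (h i j).1
      have h2 := map_incidenceForm (Int.castRingHom κ) 3503 (coverResidues i) (twinResidues j) t
      simp only [eq_intCast, Int.cast_ofNat] at h2
      rw [← h2]
      push_cast at h1
      exact sub_eq_zero.1 h1
  have hp : (3581 : κ) = 0 := by exact_mod_cast CharP.cast_eq_zero κ 3581
  have hprod : (θ - (75 : ℤ)) * ((θ - (626 : ℤ)) * ((θ - (2955 : ℤ)) * (θ - (3506 : ℤ)))) = 0 := by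
    push_cast
    linear_combination hθ + (135831555 - 2112780 * θ + 4171 * θ ^ 2 - 2 * θ ^ 3) * hp
  rcases mul_eq_zero.1 hprod with h | h
  · exact key 75 _ _ hasHadamardResidues_75 (sub_eq_zero.1 h)
  rcases mul_eq_zero.1 h with h | h
  · exact key 626 _ _ hasHadamardResidues_626 (sub_eq_zero.1 h)
  rcases mul_eq_zero.1 h with h | h
  · exact key 2955 _ _ hasHadamardResidues_2955 (sub_eq_zero.1 h)
  · exact key 3506 _ _ hasHadamardResidues_3506 (sub_eq_zero.1 h)

theorem IsCoverRoot.map {B B' : Type*} [CommRing B] [CommRing B'] (φ : B →+* B') {s u : B}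
    (h : IsCoverRoot s u) : IsCoverRoot (φ s) (φ u) := by
  simpa [IsCoverRoot, map_intEval] using congrArg φ h

theorem IsTwinRoot.map {B B' : Type*} [CommRing B] [CommRing B'] (φ : B →+* B') {s v : B}
    (h : IsTwinRoot s v) : IsTwinRoot (φ s) (φ v) := by
  simpa [IsTwinRoot, map_intEval, map_ofNat] using congrArg φ h

theorem incidenceForm_mul_sq {B : Type*} [CommRing B] [IsDomain B] [CharZero B]
    {s u u' v v' θ : B} (hθ : θ ^ 4 = 10 * θ ^ 2 - 45) (hu : IsCoverRoot s u)
    (hu' : IsCoverRoot s u') (hv : IsTwinRoot s v) (hv' : IsTwinRoot s v') (hu0 : u ≠ 0)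
    (hu0' : u' ≠ 0) (hv0 : v ≠ 0) (hv0' : v' ≠ 0) :
    (incidenceForm s u v θ * incidenceForm s u' v' θ) ^ 2 =
      (incidenceForm s u v' θ * incidenceForm s u' v θ) ^ 2 := by
  let φ := algebraMap B (FractionRing B)
  have hφ : Function.Injective φ := IsFractionRing.injective B _
  have : CharZero (FractionRing B) := charZero_of_injective_algebraMap hφ
  have h0 : ∀ {x : B}, x ≠ 0 → φ x ≠ 0 := fun h => (map_ne_zero_iff φ hφ).2 h
  have h : φ θ ^ 4 = 10 * φ θ ^ 2 - 45 := by simpa [map_ofNat] using congrArg φ hθ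
  apply hφ
  simp only [map_pow, map_mul, map_incidenceForm, mul_pow]
  rw [incidenceForm_sq h (hu.map φ) (hv.map φ) (h0 hu0) (h0 hv0),
    incidenceForm_sq h (hu'.map φ) (hv'.map φ) (h0 hu0') (h0 hv0'),
    incidenceForm_sq h (hu.map φ) (hv'.map φ) (h0 hu0) (h0 hv0'),
    incidenceForm_sq h (hu'.map φ) (hv.map φ) (h0 hu0') (h0 hv0)]
  ring

theorem hadamardSign_mul (i i' j j' : Fin 12) :
    hadamardSign i j * hadamardSign i' j' = (if hadamardMinor i i' j j' then -1 else 1) *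
      (hadamardSign i j' * hadamardSign i' j) := by
  unfold hadamardSign hadamardMinor
  cases hadamard i j <;> cases hadamard i' j' <;> cases hadamard i j' <;> cases hadamard i' j <;>
    rfl

theorem coverResidues_cast_ne_zero {κ : Type*} [Field κ] [CharP κ 3581] (i : Fin 12) :
    (coverResidues i : κ) ≠ 0 := by
  rw [Ne, CharP.intCast_eq_zero_iff κ 3581]
  revert i
  decide

theorem twinResidues_cast_ne_zero {κ : Type*} [Field κ] [CharP κ 3581] (i : Fin 12) :
    (twinResidues i : κ) ≠ 0 := by
  rw [Ne, CharP.intCast_eq_zero_iff κ 3581]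
  revert i
  decide

theorem twinResidues_cast_injective {κ : Type*} [Field κ] [CharP κ 3581] :
    Function.Injective fun i => (twinResidues i : κ) := fun i j h => by
  have h' : ((twinResidues i - twinResidues j : ℤ) : κ) = 0 := by
    push_cast
    exact sub_eq_zero.2 h
  rw [CharP.intCast_eq_zero_iff κ 3581] at h'
  clear h
  revert i j
  decide +kernel

section preserves

variable {B κ : Type*} [CommRing B] [IsDomain B] [CharZero B] [Field κ] [CharP κ 3581]
  {ψ : B →+* κ} {s : B} {u v : Fin 12 → B}

theorem incidenceForm_mul_eq (hs : ψ s = 3503) (hu : ∀ i, IsCoverRoot s (u i))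
    (hv : ∀ i, IsTwinRoot s (v i)) (hψu : ∀ i, ψ (u i) = coverResidues i)
    (hψv : ∀ i, ψ (v i) = twinResidues i) {θ : B} (hθ : θ ^ 4 = 10 * θ ^ 2 - 45)
    (i i' j j' : Fin 12) : incidenceForm s (u i) (v j) θ ≠ 0 ∧
      incidenceForm s (u i) (v j) θ * incidenceForm s (u i') (v j') θ =
        (if hadamardMinor i i' j j' then -1 else 1) *
          (incidenceForm s (u i) (v j') θ * incidenceForm s (u i') (v j) θ) := by
  have h2 : (2 : κ) ≠ 0 := by
    have := (CharP.cast_eq_zero_iff κ 3581 2).not.2 (by decide)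
    exact_mod_cast this
  have hu0 : ∀ i, u i ≠ 0 := fun i h =>
    coverResidues_cast_ne_zero (κ := κ) i (by rw [← hψu, h, map_zero])
  have hv0 : ∀ i, v i ≠ 0 := fun i h =>
    twinResidues_cast_ne_zero (κ := κ) i (by rw [← hψv, h, map_zero])
  have h : ψ θ ^ 4 = 10 * ψ θ ^ 2 - 45 := by simpa [map_ofNat] using congrArg ψ hθ
  obtain ⟨r, c, hr, hc, hrc⟩ := exists_incidenceForm_eq h
  have hψ : ∀ i j, ψ (incidenceForm s (u i) (v j) θ) = hadamardSign i j * (r i * c j) :=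
    fun i j => by rw [map_incidenceForm, hs, hψu, hψv, hrc]
  have hsign : ∀ i j, (hadamardSign i j : κ) ≠ 0 := fun i j => by
    unfold hadamardSign
    split <;> simp
  have hne : ∀ i j, ψ (incidenceForm s (u i) (v j) θ) ≠ 0 := fun i j => by
    rw [hψ]
    exact mul_ne_zero (hsign i j) (mul_ne_zero (hr i) (hc j))
  refine ⟨fun h0 => hne i j (by rw [h0, map_zero]), ?_⟩
  have hsq := sq_eq_sq_iff_eq_or_eq_neg.1
    (incidenceForm_mul_sq hθ (hu i) (hu i') (hv j) (hv j') (hu0 i) (hu0 i') (hv0 j) (hv0 j'))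
  have hs4 := congrArg (Int.cast : ℤ → κ) (hadamardSign_mul i i' j j')
  push_cast at hs4
  have hred : ψ (incidenceForm s (u i) (v j) θ * incidenceForm s (u i') (v j') θ) =
      (if hadamardMinor i i' j j' then -1 else 1) *
        ψ (incidenceForm s (u i) (v j') θ * incidenceForm s (u i') (v j) θ) := by
    simp only [map_mul, hψ]
    linear_combination r i * c j * r i' * c j' * hs4
  have hne' : ψ (incidenceForm s (u i) (v j') θ * incidenceForm s (u i') (v j) θ) ≠ 0 := by
    rw [map_mul]
    exact mul_ne_zero (hne _ _) (hne _ _)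
  rcases hsq with h1 | h1 <;> cases hm : hadamardMinor i i' j j' <;>
    simp only [hm, h1, map_neg, Bool.false_eq_true, if_false, if_true, one_mul, neg_one_mul]
      at hred ⊢
  · exact absurd ((mul_eq_zero.1 (by linear_combination hred : (2 : κ) * ψ (incidenceForm s (u i)
      (v j') θ * incidenceForm s (u i') (v j) θ) = 0)).resolve_left h2) hne'
  · exact absurd ((mul_eq_zero.1 (by linear_combination -hred : (2 : κ) * ψ (incidenceForm s (u i)
      (v j') θ * incidenceForm s (u i') (v j) θ) = 0)).resolve_left h2) hne'

theorem preservesHadamard (hs : ψ s = 3503) (hu : ∀ i, IsCoverRoot s (u i))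
    (hv : ∀ i, IsTwinRoot s (v i)) (hv' : ∀ x, IsTwinRoot s x → ∃ i, v i = x)
    (hψu : ∀ i, ψ (u i) = coverResidues i) (hψv : ∀ i, ψ (v i) = twinResidues i)
    {θ : B} (hθ : θ ^ 4 = 10 * θ ^ 2 - 45) {H : Subgroup (Equiv.Perm (Fin 12))}
    (hH : ∀ π ∈ H, ∃ g : B →+* B, Function.Injective g ∧ g s = s ∧ ∀ i, g (u i) = u (π i)) :
    PreservesHadamard H := by
  intro π hπ
  obtain ⟨g, hg, hgs, hgu⟩ := hH π hπ
  have : ∀ j, ∃ i, v i = g (v j) := fun j => hv' _ (by simpa [hgs] using (hv j).map g)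
  choose ρ hρ using this
  have hvinj : Function.Injective v := fun i j h =>
    twinResidues_cast_injective (κ := κ) (by simp only [← hψv, h])
  refine ⟨ρ, fun i j h => hvinj (hg ?_), fun i i' j j' => ?_⟩
  · rw [← hρ, ← hρ, h]
  have h : g θ ^ 4 = 10 * g θ ^ 2 - 45 := by simpa [map_ofNat] using congrArg g hθ
  have hf : ∀ i j, g (incidenceForm s (u i) (v j) θ) =
      incidenceForm s (u (π i)) (v (ρ j)) (g θ) := fun i j => by
    rw [map_incidenceForm, hgs, hgu, hρ]
  have h1 := congrArg g (incidenceForm_mul_eq hs hu hv hψu hψv hθ i i' j j').2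
  have h2 := (incidenceForm_mul_eq hs hu hv hψu hψv h (π i) (π i') (ρ j) (ρ j')).2
  have h3 := mul_ne_zero
    (incidenceForm_mul_eq hs hu hv hψu hψv h (π i) (π i') (ρ j') (ρ j')).1
    (incidenceForm_mul_eq hs hu hv hψu hψv h (π i') (π i') (ρ j) (ρ j')).1
  simp only [map_mul, hf] at h1
  rw [h2] at h1
  have h4 := mul_right_cancel₀ h3 h1
  rw [apply_ite g, map_neg, map_one] at h4
  have h1m : (1 : B) ≠ -1 := fun h => one_ne_zero (CharZero.eq_neg_self_iff.1 h)
  cases h5 : hadamardMinor (π i) (π i') (ρ j) (ρ j') <;> cases h6 : hadamardMinor i i' j j' <;>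
    simp only [h5, h6, Bool.false_eq_true, if_false, if_true] at h4 ⊢
  · exact absurd h4 h1m
  · exact absurd h4.symm h1m

end preserves

/-! ### Frobenius elements -/

theorem exists_frobenius.{v, w} {K : Type v} {L : Type w} [Field K] [Field L] [Algebra K L]
    [Algebra ℤ[X] K] [IsFractionRing ℤ[X] K] [Algebra ℤ[X] L] [IsScalarTower ℤ[X] K L]
    [FiniteDimensional K L] [IsGalois K L] (p : ℕ) [Fact p.Prime] (s : ℤ) :
    ∃ (κ : Type w) (_ : Field κ) (_ : CharP κ p) (ψ : integralClosure ℤ[X] L →+* κ)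
      (g : L ≃ₐ[K] L), ψ (algebraMap ℤ[X] _ X) = s ∧
        ∀ b b' : integralClosure ℤ[X] L, (b' : L) = g b → ψ b' = ψ b ^ p := by
  let B := integralClosure ℤ[X] L
  let φ : ℤ[X] →+* ZMod p := eval₂RingHom (Int.castRingHom _) (s : ZMod p)
  have hφ : Function.Surjective φ := ZMod.ringHom_surjective φ
  let P : Ideal ℤ[X] := RingHom.ker φ
  have hP : P.IsPrime := RingHom.ker_isPrime φ
  have hinj : Function.Injective (algebraMap ℤ[X] L) := by
    rw [IsScalarTower.algebraMap_eq ℤ[X] K L]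
    exact (algebraMap K L).injective.comp (IsFractionRing.injective ℤ[X] K)
  have : FaithfulSMul ℤ[X] L := (faithfulSMul_iff_algebraMap_injective _ _).2 hinj
  have : FaithfulSMul ℤ[X] B := (faithfulSMul_iff_algebraMap_injective _ _).2 fun x y h =>
    hinj (congrArg (algebraMap B L) h)
  have : SMulCommClass Gal(L/K) ℤ[X] L := ⟨fun g a x => by
    rw [← algebraMap_smul K a x, ← algebraMap_smul K a (g • x), smul_comm]⟩
  have : Algebra.IsInvariant ℤ[X] B Gal(L/K) := ⟨fun b hb => by
    obtain ⟨k, hk⟩ := (IsGalois.mem_range_algebraMap_iff_fixed (F := K) (b : L)).2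
      fun g => congrArg (algebraMap B L) (hb g)
    have hk' : IsIntegral ℤ[X] k := by
      rw [← isIntegral_algebraMap_iff (algebraMap K L).injective, hk]
      exact b.2
    obtain ⟨a, rfl⟩ := IsIntegrallyClosed.algebraMap_eq_of_integral hk'
    exact ⟨a, Subtype.ext (by rw [← hk, ← IsScalarTower.algebraMap_apply]; rfl)⟩⟩
  have : CharZero K := charZero_of_injective_algebraMap (IsFractionRing.injective ℤ[X] K)
  have : Module.Finite ℤ[X] B := IsIntegralClosure.finite ℤ[X] K L B
  let e : ℤ[X] ⧸ P ≃+* ZMod p := RingHom.quotientKerEquivOfSurjective hφ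
  have : Finite (ℤ[X] ⧸ P) := Finite.of_equiv _ e.symm.toEquiv
  obtain ⟨⟨Q, hQ, hQP⟩⟩ : Nonempty (P.primesOver B) := inferInstance
  have hu : Q.under ℤ[X] = P := hQP.over.symm
  have : Finite (B ⧸ Q) := Module.finite_of_finite (ℤ[X] ⧸ P)
  obtain ⟨g, hg⟩ := IsArithFrobAt.exists_of_isInvariant ℤ[X] Gal(L/K) Q
  have hcard : Nat.card (ℤ[X] ⧸ Q.under ℤ[X]) = p := by
    rw [hu, Nat.card_congr e.toEquiv, Nat.card_zmod]
  have hker : ∀ a : ℤ[X], φ a = 0 → Ideal.Quotient.mk Q (algebraMap ℤ[X] B a) = 0 := fun a ha => by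
    rw [Ideal.Quotient.eq_zero_iff_mem, ← Ideal.mem_comap]
    exact hu.ge ha
  have hQm : Q.IsMaximal := Ideal.Quotient.maximal_of_isField _ (Finite.isField_of_domain (B ⧸ Q))
  let := Ideal.Quotient.field Q
  refine ⟨B ⧸ Q, inferInstance, ?_, Ideal.Quotient.mk Q, g, ?_, fun b b' h => ?_⟩
  · have hp : ((p : ℕ) : B ⧸ Q) = 0 := by
      simpa using hker p (by simp [φ])
    obtain ⟨q, hq⟩ := CharP.exists (B ⧸ Q)
    have h1 := (CharP.cast_eq_zero_iff _ q p).1 hp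
    rcases (Nat.dvd_prime Fact.out).1 h1 with rfl | rfl
    · exact absurd rfl (CharP.char_ne_one (B ⧸ Q) 1)
    · exact hq
  · have := hker (X - C s) (by simp [φ])
    rw [map_sub, map_sub, sub_eq_zero] at this
    rw [this]
    simp
  · have h' : b' = g • b := Subtype.ext h
    have := hg.mk_apply b
    rw [hcard] at this
    rw [h']
    exact this

/-! ### Integral polynomials modulo a prime -/

/-- The ring operations on integers. -/
def intOps : CodeOps ℤ where
  zero := 0
  add := (· + ·)
  mul := (· * ·)
  neg := (- ·)
  ofInt n := n

theorem intOps_interprets (A : Type*) [CommRing A] : intOps.Interprets (Int.cast : ℤ → A) where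
  zero := Int.cast_zero
  add := Int.cast_add
  mul := Int.cast_mul
  neg := Int.cast_neg
  ofInt _ := rfl

/-- Whether all coefficients of an integral polynomial are divisible by `p`. -/
def vanishesMod (p : ℕ) (l : List ℤ) : Bool := l.all fun a => a % p == 0

/-- Whether two integral polynomials have the same coefficients modulo `p`. -/
def equalMod (p : ℕ) (l l' : List ℤ) : Bool :=
  vanishesMod p (listAdd intOps l (l'.map (- ·)))

section intEval

variable {A : Type*} [CommRing A] (x : A)

theorem intEval_cons (a : ℤ) (l : List ℤ) : intEval x (a :: l) = a + x * intEval x l := rfl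

theorem intEval_add (l l' : List ℤ) :
    intEval x (listAdd intOps l l') = intEval x l + intEval x l' :=
  listEval_add (intOps_interprets A) x l l'

theorem intEval_mul (l l' : List ℤ) :
    intEval x (listMul intOps l l') = intEval x l * intEval x l' :=
  listEval_mul (intOps_interprets A) x l l'

theorem intEval_neg (l : List ℤ) : intEval x (l.map (- ·)) = -intEval x l :=
  listEval_neg (intOps_interprets A) x l

theorem intEval_append_one (l : List ℤ) :
    intEval x (l ++ [1]) = intEval x l + x ^ l.length := by
  simp [intEval, listEval_append_singleton]

theorem intEval_take_add_drop (n : ℕ) : ∀ l : List ℤ,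
    intEval x (l.take n) + x ^ n * intEval x (l.drop n) = intEval x l := by
  induction n with
  | zero => simp [intEval, listEval]
  | succ n ih =>
    intro l
    cases l with
    | nil => simp [intEval, listEval]
    | cons a l =>
      rw [List.take_succ_cons, List.drop_succ_cons, intEval_cons, intEval_cons, ← ih l]
      ring

theorem degree_intEval_lt [Nontrivial A] (l : List ℤ) :
    (intEval (X : A[X]) l).degree < (l.length : WithBot ℕ) := by
  induction l with
  | nil => simp [intEval, listEval]
  | cons a l ih =>
    rw [intEval_cons]
    refine (degree_add_le _ _).trans_lt (max_lt ?_ ?_)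
    · rw [← C_eq_intCast]
      exact degree_C_le.trans_lt (by exact_mod_cast Nat.succ_pos _)
    · rw [X_mul, List.length_cons, Nat.cast_add, Nat.cast_one]
      by_cases h : intEval (X : A[X]) l = 0
      · rw [h, zero_mul, degree_zero]
        exact WithBot.bot_lt_coe _
      · rw [degree_mul_X]
        exact (WithBot.add_lt_add_iff_right WithBot.one_ne_bot).2 ih

variable {p : ℕ} [CharP A p] {x}

theorem intEval_map_emod (l : List ℤ) : intEval x (l.map (· % (p : ℤ))) = intEval x l := by
  induction l with
  | nil => rfl
  | cons a l ih =>
    rw [List.map_cons, intEval_cons, intEval_cons, ih]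
    congr 1
    exact (CharP.intCast_eq_intCast_mod A p).symm

theorem intEval_eq_zero_of_vanishesMod {l : List ℤ} (h : vanishesMod p l = true) :
    intEval x l = 0 :=
  listEval_eq_zero fun a ha => by
    have := List.all_eq_true.1 h a ha
    rw [CharP.intCast_eq_zero_iff A p]
    exact Int.dvd_of_emod_eq_zero (by simpa using this)

theorem intEval_eq_of_equalMod {l l' : List ℤ} (h : equalMod p l l' = true) :
    intEval x l = intEval x l' := by
  have := intEval_eq_zero_of_vanishesMod (x := x) h
  rw [intEval_add, intEval_neg] at this
  linear_combination this

end intEval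

/-- Given the remainder `r` of a polynomial modulo `X ^ t.length - t`, the remainder of its product
by `X` plus `a`. -/
def remStep (p : ℕ) (t : List ℤ) (a : ℤ) (r : List ℤ) : List ℤ :=
  (listAdd intOps (a :: r.take (t.length - 1)) (listMul intOps (r.drop (t.length - 1)) t)).map
    (· % (p : ℤ))

/-- The remainder of a polynomial modulo `X ^ t.length - t`. -/
def remList (p : ℕ) (t l : List ℤ) : List ℤ := l.foldr (remStep p t) []

/-- The remainders of `X ^ p ^ k` modulo `X ^ t.length - t`. -/
def frobeniusRem (p : ℕ) (t : List ℤ) : ℕ → List ℤ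
  | 0 => [0, 1]
  | k + 1 => (fun q => remList p t (listMul intOps (frobeniusRem p t k) q))^[p] [1]

/-- The product of `X ^ p ^ k - X` over the positive `k < n`, modulo `X ^ t.length - t`. -/
def frobeniusDiffProd (p : ℕ) (t : List ℤ) : ℕ → List ℤ
  | 0 => [1]
  | 1 => [1]
  | k + 2 => remList p t (listMul intOps (listAdd intOps (frobeniusRem p t (k + 1)) [0, -1])
      (frobeniusDiffProd p t (k + 1)))

section root

variable {A : Type*} [CommRing A] {x : A} {p : ℕ} [CharP A p] {t : List ℤ}

theorem intEval_remList (ht : t ≠ []) (hx : intEval x t = x ^ t.length) (l : List ℤ) :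
    intEval x (remList p t l) = intEval x l := by
  induction l with
  | nil => rfl
  | cons a l ih =>
    have h := intEval_take_add_drop x (t.length - 1) (remList p t l)
    have hlen : x ^ t.length = x * x ^ (t.length - 1) := by
      rw [← pow_succ', Nat.sub_add_cancel (List.length_pos_iff.2 ht)]
    change intEval x (remStep p t a (remList p t l)) = intEval x (a :: l)
    rw [remStep, intEval_map_emod, intEval_add, intEval_mul, hx, hlen]
    rw [intEval_cons, intEval_cons, ← ih]
    linear_combination x * h

theorem intEval_frobeniusRem (ht : t ≠ []) (hx : intEval x t = x ^ t.length) (k : ℕ) :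
    intEval x (frobeniusRem p t k) = x ^ p ^ k := by
  induction k with
  | zero => simp [frobeniusRem, intEval, listEval]
  | succ k ih =>
    have : ∀ n, intEval x ((fun q => remList p t (listMul intOps (frobeniusRem p t k) q))^[n] [1])
        = (x ^ p ^ k) ^ n := fun n => by
      induction n with
      | zero => simp [intEval, listEval]
      | succ n ihn => rw [Function.iterate_succ_apply', intEval_remList ht hx, intEval_mul, ihn, ih,
          pow_succ']
    rw [frobeniusRem, this, ← pow_mul, pow_succ]

theorem intEval_frobeniusDiffProd (ht : t ≠ []) (hx : intEval x t = x ^ t.length) {n k : ℕ}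
    (hk : 0 < k) (hkn : k < n) (h : x ^ p ^ k = x) : intEval x (frobeniusDiffProd p t n) = 0 := by
  induction n with
  | zero => omega
  | succ n ih =>
    obtain _ | n := n
    · omega
    rw [frobeniusDiffProd, intEval_remList ht hx, intEval_mul, intEval_add,
      intEval_frobeniusRem ht hx]
    rcases (Nat.lt_succ_iff.1 hkn).eq_or_lt with rfl | h'
    · simp [h, intEval, listEval]
    · rw [ih h', mul_zero]

end root

/-! ### The cycle type of a Frobenius element -/

/-- The polynomial whose roots are the roots of the first covering at the parameter `s`. -/
noncomputable def coverPoly {A : Type*} [CommRing A] (s : A) : A[X] :=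
  intEval X coverCoeffs0 + C s * intEval X coverCoeffs1 + C s ^ 2 * intEval X coverCoeffs2

/-- The polynomial whose roots are the roots of the second covering at the parameter `s`. -/
noncomputable def twinPoly {A : Type*} [CommRing A] (s : A) : A[X] :=
  intEval X twinCoeffs - 51200 * 3 ^ 9 * C s * X ^ 2

section poly

variable {A : Type*} [CommRing A]

theorem eval_intEval_X (x : A) (l : List ℤ) : (intEval X l).eval x = intEval x l := by
  rw [← coe_evalRingHom, map_intEval, coe_evalRingHom, eval_X]

theorem map_intEval_X {A' : Type*} [CommRing A'] (φ : A →+* A') (l : List ℤ) :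
    (intEval (X : A[X]) l).map φ = intEval X l := by
  rw [← coe_mapRingHom, map_intEval, coe_mapRingHom, map_X]

theorem isRoot_coverPoly {s x : A} : (coverPoly s).IsRoot x ↔ IsCoverRoot s x := by
  simp [IsRoot.def, coverPoly, IsCoverRoot, eval_intEval_X]

theorem isRoot_twinPoly {s x : A} : (twinPoly s).IsRoot x ↔ IsTwinRoot s x := by
  simp [IsRoot.def, twinPoly, IsTwinRoot, eval_intEval_X, sub_eq_zero]

theorem map_coverPoly {A' : Type*} [CommRing A'] (φ : A →+* A') (s : A) :
    (coverPoly s).map φ = coverPoly (φ s) := by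
  simp [coverPoly, map_intEval_X]

theorem map_twinPoly {A' : Type*} [CommRing A'] (φ : A →+* A') (s : A) :
    (twinPoly s).map φ = twinPoly (φ s) := by
  simp [twinPoly, map_intEval_X]

theorem exists_coverPoly_eq [Nontrivial A] (s : A) :
    ∃ q : A[X], q.degree < (12 : ℕ) ∧ coverPoly s = X ^ 12 + q := by
  have h0 : coverCoeffs0 = coverCoeffs0.take 12 ++ [1] := by decide
  refine ⟨intEval X (coverCoeffs0.take 12) + C s * intEval X coverCoeffs1 +
    C s ^ 2 * intEval X coverCoeffs2, ?_, ?_⟩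
  · rw [← C_pow]
    refine (degree_add_le _ _).trans_lt (max_lt ((degree_add_le _ _).trans_lt (max_lt ?_ ?_)) ?_)
    · exact degree_intEval_lt _
    · rw [← smul_eq_C_mul]
      exact ((degree_smul_le _ _).trans_lt (degree_intEval_lt _)).trans (by decide)
    · rw [← smul_eq_C_mul]
      exact ((degree_smul_le _ _).trans_lt (degree_intEval_lt _)).trans (by decide)
  · rw [coverPoly, h0, intEval_append_one]
    simp only [← h0]
    rw [show (coverCoeffs0.take 12).length = 12 from rfl]
    ring

theorem exists_twinPoly_eq [Nontrivial A] (s : A) :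
    ∃ q : A[X], q.degree < (12 : ℕ) ∧ twinPoly s = X ^ 12 + q := by
  have h0 : twinCoeffs = twinCoeffs.take 12 ++ [1] := by decide
  refine ⟨intEval X (twinCoeffs.take 12) - 51200 * 3 ^ 9 * C s * X ^ 2, ?_, ?_⟩
  · refine (degree_sub_le _ _).trans_lt (max_lt (degree_intEval_lt _) ?_)
    have : (51200 * 3 ^ 9 * C s : A[X]) = C (51200 * 3 ^ 9 * s) := by simp [map_ofNat]
    rw [this]
    exact (degree_C_mul_X_pow_le _ _).trans_lt (by decide)
  · rw [twinPoly, h0, intEval_append_one, ← h0]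
    rw [show (twinCoeffs.take 12).length = 12 from rfl]
    ring

theorem monic_natDegree_of_eq_X_pow_add [Nontrivial A] {f : A[X]} {n : ℕ}
    (h : ∃ q : A[X], q.degree < n ∧ f = X ^ n + q) : f.Monic ∧ f.natDegree = n := by
  obtain ⟨q, hq, rfl⟩ := h
  refine ⟨monic_X_pow_add hq, ?_⟩
  rw [natDegree_add_eq_left_of_degree_lt (by rwa [degree_X_pow]), natDegree_X_pow]

theorem monic_coverPoly [Nontrivial A] (s : A) : (coverPoly s).Monic :=
  (monic_natDegree_of_eq_X_pow_add (exists_coverPoly_eq s)).1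

theorem natDegree_coverPoly [Nontrivial A] (s : A) : (coverPoly s).natDegree = 12 :=
  (monic_natDegree_of_eq_X_pow_add (exists_coverPoly_eq s)).2

theorem monic_twinPoly [Nontrivial A] (s : A) : (twinPoly s).Monic :=
  (monic_natDegree_of_eq_X_pow_add (exists_twinPoly_eq s)).1

theorem natDegree_twinPoly [Nontrivial A] (s : A) : (twinPoly s).natDegree = 12 :=
  (monic_natDegree_of_eq_X_pow_add (exists_twinPoly_eq s)).2

end poly

/-- The coefficients of `coverPoly` at an integral parameter. -/
def coverList (s : ℤ) : List ℤ :=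
  listAdd intOps (listAdd intOps coverCoeffs0 (listMul intOps [s] coverCoeffs1))
    (listMul intOps [s ^ 2] coverCoeffs2)

/-- The coefficients of the monic polynomial `X ^ t.length - t`. -/
def monicList (t : List ℤ) : List ℤ := t.map (- ·) ++ [1]

/-- The product of the polynomials `X ^ l.length - l` over the members `l` of `t`. -/
def prodList (t : List (List ℤ)) : List ℤ :=
  t.foldr (fun l q => listMul intOps (monicList l) q) [1]

section

variable {A : Type*} [CommRing A] (x : A)

theorem intEval_coverList (s : ℤ) : intEval (X : A[X]) (coverList s) = coverPoly (s : A) := by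
  have h (n : ℤ) : intEval (X : A[X]) [n] = n := by simp [intEval, listEval]
  simp [coverList, coverPoly, intEval_add, intEval_mul, h]

theorem intEval_monicList (t : List ℤ) :
    intEval x (monicList t) = x ^ t.length - intEval x t := by
  rw [monicList, intEval_append_one, intEval_neg, List.length_map]
  ring

theorem intEval_prodList (t : List (List ℤ)) :
    intEval x (prodList t) = (t.map fun l => intEval x (monicList l)).prod := by
  induction t with
  | nil => simp [prodList, intEval, listEval]
  | cons l t ih =>
    rw [List.map_cons, List.prod_cons, ← ih, ← intEval_mul]
    rfl

theorem degree_intEval_monicList {κ : Type*} [Field κ] (t : List ℤ) :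
    (intEval (X : κ[X]) (monicList t)).degree = (t.length : WithBot ℕ) := by
  rw [intEval_monicList, degree_sub_eq_left_of_degree_lt, degree_X_pow]
  rw [degree_X_pow]
  exact degree_intEval_lt t

end

/-- The factors `X ^ l.length - l`, for `l` in `t`, of `coverPoly` at the parameter `s` are
irreducible modulo `p` and pairwise coprime, as certified by `w`, and `c` is the Frobenius action
if its index `i` stands for the `p ^ k i`-th power of a root of the factor number `f i`. -/
def HasFrobeniusType (p : ℕ) (s : ℤ) (c : Equiv.Perm (Fin 12)) (t w : List (List ℤ))
    (f k : Fin 12 → ℕ) : Prop :=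
  equalMod p (prodList t) (coverList s) = true ∧
  (∀ i < t.length, t.getD i [] ≠ [] ∧
    equalMod p (frobeniusRem p (t.getD i []) (t.getD i []).length) (remList p (t.getD i []) [0, 1])
      = true ∧
    equalMod p (remList p (t.getD i []) (listMul intOps (frobeniusDiffProd p (t.getD i [])
      (t.getD i []).length) (listMul intOps (prodList (t.eraseIdx i)) (w.getD i [])))) [1] = true) ∧
  (∀ i j, f i = f j → k i = k j → i = j) ∧
  ∀ i, f i < t.length ∧ k i < (t.getD (f i) []).length ∧ f (c i) = f i ∧
    k (c i) = (k i + 1) % (t.getD (f i) []).length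

instance (p : ℕ) (s : ℤ) (c : Equiv.Perm (Fin 12)) (t w : List (List ℤ)) (f k : Fin 12 → ℕ) :
    Decidable (HasFrobeniusType p s c t w f k) :=
  inferInstanceAs (Decidable (_ ∧ _))

theorem exists_perm_of_injective {κ : Type*} {r a : Fin 12 → κ} (ha : Function.Injective a)
    (h : ∀ i, ∃ j, r j = a i) :
    Function.Injective r ∧ ∃ e : Equiv.Perm (Fin 12), ∀ i, r (e i) = a i := by
  choose e he using h
  have hinj : Function.Injective e := fun i j hij => ha (by rw [← he, ← he, hij])
  have hbij := Finite.injective_iff_bijective.1 hinj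
  refine ⟨fun x y hxy => ?_, Equiv.ofBijective e hbij, he⟩
  obtain ⟨i, rfl⟩ := hbij.2 x
  obtain ⟨j, rfl⟩ := hbij.2 y
  rw [he, he] at hxy
  rw [ha hxy]

section frobenius

variable {κ : Type*} [Field κ] {p : ℕ} [CharP κ p] [Fact p.Prime]

theorem intEval_pow_char_pow (x : κ) (k : ℕ) (l : List ℤ) :
    intEval (x ^ p ^ k) l = intEval x l ^ p ^ k := by
  rw [← iterateFrobenius_def, ← iterateFrobenius_def, map_intEval]

theorem HasFrobeniusType.exists_perm {s : ℤ} {c : Equiv.Perm (Fin 12)} {t w : List (List ℤ)}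
    {f k : Fin 12 → ℕ} (h : HasFrobeniusType p s c t w f k) {r : Fin 12 → κ}
    (hr : coverPoly (s : κ) = ∏ i, (X - C (r i))) :
    Function.Injective r ∧ ∃ e : Equiv.Perm (Fin 12), ∀ i, r (e (c i)) = r (e i) ^ p := by
  obtain ⟨hprod, hfac, hfk, hc⟩ := h
  have hroot : ∀ {x : κ}, IsCoverRoot (s : κ) x → ∃ j, r j = x := fun {x} hx => by
    rw [← isRoot_coverPoly, hr, IsRoot.def, eval_prod, Finset.prod_eq_zero_iff] at hx
    obtain ⟨j, -, hj⟩ := hx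
    exact ⟨j, by simpa [sub_eq_zero, eq_comm] using hj⟩
  have hdvd : ∀ l ∈ t, intEval X (monicList l) ∣ coverPoly (s : κ) := fun l hl => by
    rw [← intEval_coverList, ← intEval_eq_of_equalMod hprod, intEval_prodList]
    exact List.dvd_prod (List.mem_map_of_mem hl)
  have hex : ∀ i, ∃ x : κ, i < t.length → intEval x (monicList (t.getD i [])) = 0 := fun i => by
    by_cases hi : i < t.length
    · have hmem : t.getD i [] ∈ t := by
        rw [List.getD_eq_getElem _ _ hi]
        exact List.getElem_mem hi
      have hsplit : (coverPoly (s : κ)).Splits := by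
        rw [hr]
        exact Splits.prod fun i _ => Splits.X_sub_C _
      have hdeg := degree_intEval_monicList (κ := κ) (t.getD i [])
      obtain ⟨x, hx⟩ :=
        (hsplit.of_dvd (monic_coverPoly _).ne_zero (hdvd _ hmem)).exists_eval_eq_zero
        (by
          rw [hdeg]
          exact_mod_cast (List.length_pos_iff.2 (hfac i hi).1).ne')
      rw [eval_intEval_X] at hx
      exact ⟨x, fun _ => hx⟩
    · exact ⟨0, fun h => absurd h hi⟩
  choose a ha using hex
  have hpow : ∀ i, i < t.length → intEval (a i) (t.getD i []) = a i ^ (t.getD i []).length :=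
    fun i hi => by
      have := ha i hi
      rw [intEval_monicList, sub_eq_zero] at this
      exact this.symm
  have h01 : ∀ x : κ, intEval x [0, 1] = x := fun x => by simp [intEval, listEval]
  have hper : ∀ i, i < t.length → a i ^ p ^ (t.getD i []).length = a i := fun i hi => by
    obtain ⟨h1, h2, -⟩ := hfac i hi
    have := intEval_eq_of_equalMod (x := a i) h2
    rwa [intEval_frobeniusRem h1 (hpow i hi), intEval_remList h1 (hpow i hi), h01] at this
  have hunit : ∀ i, i < t.length → intEval (a i) (frobeniusDiffProd p (t.getD i [])
      (t.getD i []).length) * (intEval (a i) (prodList (t.eraseIdx i)) *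
        intEval (a i) (w.getD i [])) = 1 := fun i hi => by
    obtain ⟨h1, -, h3⟩ := hfac i hi
    have := intEval_eq_of_equalMod (x := a i) h3
    rw [intEval_remList h1 (hpow i hi), intEval_mul, intEval_mul] at this
    rw [this]
    simp [intEval, listEval]
  have hne : ∀ i, i < t.length → ∀ m, 0 < m → m < (t.getD i []).length → a i ^ p ^ m ≠ a i :=
    fun i hi m hm hmd heq => by
      have := hunit i hi
      rw [intEval_frobeniusDiffProd (hfac i hi).1 (hpow i hi) hm hmd heq, zero_mul] at this
      exact zero_ne_one this
  have hne' : ∀ i j, i < t.length → j < t.length → j ≠ i →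
      intEval (a i) (monicList (t.getD j [])) ≠ 0 := fun i j hi hj hij heq => by
    have := hunit i hi
    rw [intEval_prodList, List.prod_eq_zero, zero_mul, mul_zero] at this
    · exact zero_ne_one this
    · refine List.mem_map.2 ⟨t.getD j [], ?_, heq⟩
      rw [List.mem_eraseIdx_iff_getElem]
      exact ⟨j, hj, hij, (List.getD_eq_getElem _ _ hj).symm⟩
  have hp : 0 < p := (Fact.out : p.Prime).pos
  have hinjF : ∀ m, Function.Injective fun x : κ => x ^ p ^ m := fun m =>
    (iterateFrobenius κ p m).injective
  have hkey : ∀ i m m', i < t.length → m ≤ m' → m' < (t.getD i []).length →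
      a i ^ p ^ m = a i ^ p ^ m' → m = m' := fun i m m' hi hmm hm' heq => by
    by_contra hcon
    refine hne i hi (m' - m) (by omega) (by omega) (hinjF m ?_)
    change (a i ^ p ^ (m' - m)) ^ p ^ m = a i ^ p ^ m
    rw [← pow_mul, ← pow_add, Nat.sub_add_cancel hmm, heq]
  have hinj : Function.Injective fun i => a (f i) ^ p ^ k i := fun i j hij => by
    obtain ⟨hi, hki, -, -⟩ := hc i
    obtain ⟨hj, hkj, -, -⟩ := hc j
    simp only at hij
    by_cases hf : f i = f j
    · refine hfk i j hf ?_
      rw [hf] at hij hki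
      rcases le_total (k i) (k j) with hle | hle
      · exact hkey _ _ _ hj hle hkj hij
      · exact (hkey _ _ _ hj hle hki hij.symm).symm
    · refine absurd ?_ (hne' (f i) (f j) hi hj (Ne.symm hf))
      have h1 := intEval_pow_char_pow (p := p) (a (f j)) (k j) (monicList (t.getD (f j) []))
      rw [ha _ hj, zero_pow (pow_pos hp _).ne', ← hij, intEval_pow_char_pow] at h1
      exact (pow_eq_zero_iff (pow_pos hp _).ne').1 h1
  obtain ⟨h1, e, he⟩ := exists_perm_of_injective (r := r) hinj fun i => hroot (by
    obtain ⟨hi, -⟩ := hc i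
    have hmem : t.getD (f i) [] ∈ t := by
      rw [List.getD_eq_getElem _ _ hi]
      exact List.getElem_mem hi
    have hx : (coverPoly (s : κ)).IsRoot (a (f i)) := by
      refine IsRoot.dvd ?_ (hdvd _ hmem)
      rw [IsRoot.def, eval_intEval_X]
      exact ha _ hi
    simpa [iterateFrobenius_def] using (isRoot_coverPoly.1 hx).map (iterateFrobenius κ p (k i)))
  refine ⟨h1, e, fun i => ?_⟩
  obtain ⟨hi, hki, hfc, hkc⟩ := hc i
  rw [he, he, hfc, hkc, ← pow_mul, ← pow_succ]
  rcases (Nat.succ_le_of_lt hki).eq_or_lt with hk | hk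
  · rw [Nat.succ_eq_add_one] at hk
    rw [hk, Nat.mod_self, pow_zero, pow_one, hper _ hi]
  · rw [Nat.mod_eq_of_lt hk]

end frobenius

theorem hasFrobeniusType_cyclePerm11 : HasFrobeniusType 7 1 cyclePerm11
    [[5, 1, 6, 6, 1, 2, 1, 5, 6, 4, 2], [5]]
    [[1, 3, 2, 4, 5, 0, 4, 2, 5, 2, 5], [1]]
    ![0, 0, 0, 0, 0, 0, 0, 0, 0, 0, 0, 1] ![0, 1, 2, 3, 4, 5, 6, 7, 8, 9, 10, 0] := by
  decide +kernel

theorem hasFrobeniusType_cyclePerm10 : HasFrobeniusType 11 5 cyclePerm10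
    [[7, 5, 9, 5, 8, 2, 5, 0, 1, 0], [6, 0]]
    [[1, 7, 1, 1, 5, 4, 1, 2, 6, 6], [8, 4]]
    ![0, 0, 0, 0, 0, 0, 0, 0, 0, 0, 1, 1] ![0, 1, 2, 3, 4, 5, 6, 7, 8, 9, 0, 1] := by
  decide +kernel

theorem hasFrobeniusType_cyclePerm8 : HasFrobeniusType 7 2 cyclePerm8
    [[3, 5, 5, 1, 0, 2, 6, 2], [5, 0], [0], [5]]
    [[0, 1, 5, 1, 0, 5, 5, 5], [1, 4], [4], [5]]
    ![0, 0, 0, 0, 0, 0, 0, 0, 1, 1, 2, 3] ![0, 1, 2, 3, 4, 5, 6, 7, 0, 1, 0, 0] := by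
  decide +kernel

theorem hasFrobeniusType_cyclePerm6 : HasFrobeniusType 7 3 cyclePerm6
    [[5, 3, 1, 2, 2, 4], [2, 1, 2], [3, 6], [2]]
    [[4, 0, 0, 6, 4, 5], [6, 5, 6], [5, 5], [3]]
    ![0, 0, 0, 0, 0, 0, 1, 1, 1, 2, 2, 3] ![0, 1, 2, 3, 4, 5, 0, 1, 2, 0, 1, 0] := by
  decide +kernel

/-! ### The Galois group of the first covering -/

theorem exists_roots_integralClosure {R L : Type*} [CommRing R] [Field L] [Algebra R L] {f : R[X]}
    (hf : f.Monic) (hdeg : f.natDegree = 12) (hs : (f.map (algebraMap R L)).Splits) :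
    ∃ w : Fin 12 → integralClosure R L,
      f.map (algebraMap R (integralClosure R L)) = ∏ i, (X - C (w i)) := by
  let l := (f.map (algebraMap R L)).roots.toList
  have hl : l.length = 12 := by
    rw [Multiset.length_toList, ← hs.natDegree_eq_card_roots, hf.natDegree_map, hdeg]
  have hprod : f.map (algebraMap R L) = ∏ i : Fin 12, (X - C (l.get (Fin.cast hl.symm i))) := by
    rw [hs.eq_prod_roots_of_monic (hf.map _)]
    conv_lhs => rw [← Multiset.coe_toList (f.map (algebraMap R L)).roots, Multiset.map_coe,
      Multiset.prod_coe, ← List.ofFn_get (f.map (algebraMap R L)).roots.toList]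
    rw [List.map_ofFn, List.prod_ofFn]
    exact (Equiv.prod_comp (finCongr hl) fun i => X - C (l.get (Fin.cast hl.symm i)))
  have hint : ∀ i : Fin 12, IsIntegral R (l.get (Fin.cast hl.symm i)) := fun i => by
    refine ⟨f, hf, ?_⟩
    rw [← eval_map, hprod, eval_prod]
    exact Finset.prod_eq_zero (Finset.mem_univ i) (by simp)
  refine ⟨fun i => ⟨_, hint i⟩, ?_⟩
  refine map_injective (algebraMap (integralClosure R L) L) Subtype.val_injective ?_
  rw [map_map, ← IsScalarTower.algebraMap_eq, hprod, Polynomial.map_prod]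
  simp

/-- The permutations of the values of `u` induced by automorphisms of `L` over `K`. -/
def rootPerms (K : Type*) {L : Type*} [Field K] [Field L] [Algebra K L] (u : Fin 12 → L) :
    Subgroup (Equiv.Perm (Fin 12)) where
  carrier := {π | ∃ g : L ≃ₐ[K] L, ∀ i, g (u i) = u (π i)}
  one_mem' := ⟨1, fun _ => rfl⟩
  mul_mem' := by
    rintro π π' ⟨g, hg⟩ ⟨g', hg'⟩
    exact ⟨g * g', fun i => by
      rw [AlgEquiv.mul_apply, hg', hg, Equiv.Perm.mul_apply]⟩
  inv_mem' := by
    rintro π ⟨g, hg⟩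
    refine ⟨g⁻¹, fun i => g.injective ?_⟩
    rw [hg, ← Equiv.Perm.mul_apply, ← AlgEquiv.mul_apply, mul_inv_cancel, mul_inv_cancel]
    rfl

section Galois

variable {K L : Type*} [Field K] [Field L] [Algebra K L]

theorem exists_perm_of_algEquiv {f : K[X]} {u : Fin 12 → L} (hinj : Function.Injective u)
    (hu : ∀ x, aeval x f = 0 ↔ ∃ i, u i = x) (g : L ≃ₐ[K] L) :
    ∃ π : Equiv.Perm (Fin 12), ∀ i, g (u i) = u (π i) := by
  obtain ⟨-, e, he⟩ := exists_perm_of_injective (r := u) (a := fun i => g (u i))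
    (g.injective.comp hinj) fun i => (hu _).1 (by
      rw [aeval_algHom_apply, (hu _).2 ⟨i, rfl⟩, map_zero])
  exact ⟨e, fun i => (he i).symm⟩

theorem card_gal_eq_card_rootPerms [Normal K L] {f : K[X]} (hf : f ≠ 0)
    (hs : (f.map (algebraMap K L)).Splits) {u : Fin 12 → L} (hinj : Function.Injective u)
    (hu : ∀ x, aeval x f = 0 ↔ ∃ i, u i = x) : Nat.card f.Gal = Nat.card (rootPerms K u) := by
  have : Fact (f.map (algebraMap K L)).Splits := ⟨hs⟩
  choose g hg using fun π : rootPerms K u => π.2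
  refine (Nat.card_congr (Equiv.ofBijective (fun π => Gal.restrict f L (g π)) ⟨?_, ?_⟩)).symm
  · intro π π' h
    refine Subtype.ext (Equiv.ext fun i => hinj ?_)
    have hx : u i ∈ f.rootSet L := (mem_rootSet.2 ⟨hf, (hu _).2 ⟨i, rfl⟩⟩)
    rw [← hg, ← hg, ← Gal.restrict_smul (p := f) (g π) ⟨u i, hx⟩,
      ← Gal.restrict_smul (p := f) (g π') ⟨u i, hx⟩]
    exact congrArg (fun σ : f.Gal => ((σ • (⟨u i, hx⟩ : f.rootSet L) : f.rootSet L) : L)) h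
  · intro σ
    obtain ⟨γ, rfl⟩ := Gal.restrict_surjective f L σ
    obtain ⟨π, hπ⟩ := exists_perm_of_algEquiv hinj hu γ
    refine ⟨⟨π, γ, hπ⟩, Gal.galActionHom_injective f L (Equiv.ext fun x => Subtype.ext ?_)⟩
    rw [Gal.galActionHom_restrict, Gal.galActionHom_restrict]
    obtain ⟨i, hi⟩ := (hu x).1 (mem_rootSet.1 x.2).2
    rw [← hi, hg, hπ]

end Galois

section cover

variable {K : Type*} {L : Type*} [Field K] [Field L] [Algebra K L] [Algebra ℤ[X] K]
  [Algebra ℤ[X] L] [IsScalarTower ℤ[X] K L]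

theorem aeval_coverPoly_eq_zero_iff {u : Fin 12 → integralClosure ℤ[X] L}
    (hu : coverPoly (algebraMap ℤ[X] (integralClosure ℤ[X] L) X) = ∏ i, (X - C (u i))) (x : L) :
    aeval x (coverPoly (algebraMap ℤ[X] K X)) = 0 ↔ ∃ i, (u i : L) = x := by
  have := congrArg (Polynomial.map (algebraMap (integralClosure ℤ[X] L) L)) hu
  rw [map_coverPoly, ← IsScalarTower.algebraMap_apply, Polynomial.map_prod] at this
  rw [aeval_def, ← eval_map, map_coverPoly, ← IsScalarTower.algebraMap_apply, this, eval_prod,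
    Finset.prod_eq_zero_iff]
  simp [sub_eq_zero, eq_comm]

variable [IsFractionRing ℤ[X] K] [FiniteDimensional K L] [IsGalois K L]

theorem HasFrobeniusType.meetsConjClass {p : ℕ} [Fact p.Prime] {s : ℤ} {c : Equiv.Perm (Fin 12)}
    {t w : List (List ℤ)} {f k : Fin 12 → ℕ} (h : HasFrobeniusType p s c t w f k)
    {u : Fin 12 → integralClosure ℤ[X] L}
    (hu : coverPoly (algebraMap ℤ[X] (integralClosure ℤ[X] L) X) = ∏ i, (X - C (u i))) :
    MeetsConjClass (rootPerms K fun i => (u i : L)) c := by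
  obtain ⟨κ, _, _, ψ, g, hs, hg⟩ := exists_frobenius (K := K) (L := L) p s
  have hr : coverPoly (s : κ) = ∏ i, (X - C (ψ (u i))) := by
    rw [← hs, ← map_coverPoly, hu, Polynomial.map_prod]
    simp
  obtain ⟨hinj, e, he⟩ := h.exists_perm hr
  have huinj : Function.Injective fun i => (u i : L) := fun i j hij =>
    hinj (congrArg ψ (Subtype.ext hij))
  obtain ⟨π, hπ⟩ := exists_perm_of_algEquiv huinj
    (aeval_coverPoly_eq_zero_iff (K := K) hu) g
  refine ⟨π, ⟨g, hπ⟩, e, fun i => hinj ?_⟩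
  change ψ (u (π (e i))) = ψ (u (e (c i)))
  rw [he, hg _ _ (hπ (e i)).symm]

end cover

theorem coverResidues_isRoot (i : Fin 12) :
    (intEval (coverResidues i) coverCoeffs0 + 3503 * intEval (coverResidues i) coverCoeffs1 +
      3503 ^ 2 * intEval (coverResidues i) coverCoeffs2) % 3581 = 0 := by
  revert i
  decide +kernel

theorem twinResidues_isRoot (i : Fin 12) :
    (intEval (twinResidues i) twinCoeffs - 51200 * 3 ^ 9 * 3503 * twinResidues i ^ 2) % 3581 =
      0 := by
  revert i
  decide +kernel

section residues

variable {κ : Type*} [Field κ] [CharP κ 3581]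

theorem isCoverRoot_coverResidues (i : Fin 12) : IsCoverRoot 3503 (coverResidues i : κ) := by
  have h := Int.dvd_of_emod_eq_zero (coverResidues_isRoot i)
  rw [← Nat.cast_ofNat, ← CharP.intCast_eq_zero_iff κ 3581, ← eq_intCast (Int.castRingHom κ)] at h
  simp only [map_add, map_mul, map_pow, map_ofNat] at h
  simp only [map_intEval] at h
  exact h

theorem isTwinRoot_twinResidues (i : Fin 12) : IsTwinRoot 3503 (twinResidues i : κ) := by
  have h := Int.dvd_of_emod_eq_zero (twinResidues_isRoot i)
  rw [← Nat.cast_ofNat, ← CharP.intCast_eq_zero_iff κ 3581, ← eq_intCast (Int.castRingHom κ)] at h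
  simp only [map_sub, map_mul, map_pow, map_ofNat] at h
  simp only [map_intEval] at h
  exact sub_eq_zero.1 h

theorem coverResidues_cast_injective : Function.Injective fun i => (coverResidues i : κ) :=
    fun i j h => by
  have h' : ((coverResidues i - coverResidues j : ℤ) : κ) = 0 := by
    push_cast
    exact sub_eq_zero.2 h
  rw [CharP.intCast_eq_zero_iff κ 3581] at h'
  clear h
  revert i j
  decide +kernel

end residues

theorem exists_reindex {B κ : Type*} [CommRing B] [Field κ] (ψ : B →+* κ) {f : B[X]}
    {u : Fin 12 → B} (hu : f = ∏ i, (X - C (u i))) {a : Fin 12 → κ} (ha : Function.Injective a)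
    (hroot : ∀ i, (f.map ψ).IsRoot (a i)) :
    ∃ u' : Fin 12 → B, f = ∏ i, (X - C (u' i)) ∧ ∀ i, ψ (u' i) = a i := by
  obtain ⟨-, e, he⟩ := exists_perm_of_injective (r := fun i => ψ (u i)) ha fun i => by
    have h := hroot i
    rw [hu, IsRoot.def, Polynomial.map_prod, eval_prod, Finset.prod_eq_zero_iff] at h
    obtain ⟨j, -, hj⟩ := h
    rw [Polynomial.map_sub, map_X, map_C, eval_sub, eval_X, eval_C, sub_eq_zero] at hj
    exact ⟨j, hj.symm⟩
  exact ⟨fun i => u (e i), by rw [hu, Equiv.prod_comp e fun i => X - C (u i)], he⟩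

section card

variable {K L : Type*} [Field K] [Field L] [Algebra K L] [Algebra ℤ[X] K] [IsFractionRing ℤ[X] K]
  [Algebra ℤ[X] L] [IsScalarTower ℤ[X] K L] [FiniteDimensional K L] [IsGalois K L]

theorem isRoot_prod_iff {B : Type*} [CommRing B] [IsDomain B] {u : Fin 12 → B} {x : B} :
    (∏ i, (X - C (u i))).IsRoot x ↔ ∃ i, u i = x := by
  rw [IsRoot.def, eval_prod, Finset.prod_eq_zero_iff]
  simp [sub_eq_zero, eq_comm]

theorem exists_coverRoots_card_rootPerms
    (hc : (coverPoly (algebraMap ℤ[X] L X)).Splits) (ht : (twinPoly (algebraMap ℤ[X] L X)).Splits)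
    {θ : L} (hθ : θ ^ 4 = 10 * θ ^ 2 - 45) : ∃ u : Fin 12 → L, Function.Injective u ∧
      (∀ x, aeval x (coverPoly (algebraMap ℤ[X] K X)) = 0 ↔ ∃ i, u i = x) ∧
      Nat.card (rootPerms K u) = 95040 := by
  have : Fact (Nat.Prime 3581) := ⟨by norm_num⟩
  have : Fact (Nat.Prime 7) := ⟨by norm_num⟩
  have : Fact (Nat.Prime 11) := ⟨by norm_num⟩
  have hinj : Function.Injective (algebraMap ℤ[X] L) := by
    rw [IsScalarTower.algebraMap_eq ℤ[X] K L]
    exact (algebraMap K L).injective.comp (IsFractionRing.injective ℤ[X] K)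
  have : CharZero L := charZero_of_injective_algebraMap hinj
  let B := integralClosure ℤ[X] L
  let s : B := algebraMap ℤ[X] B X
  obtain ⟨u₀, hu₀⟩ := exists_roots_integralClosure (L := L) (monic_coverPoly (X : ℤ[X]))
    (natDegree_coverPoly X) (by rw [map_coverPoly]; exact hc)
  obtain ⟨v₀, hv₀⟩ := exists_roots_integralClosure (L := L) (monic_twinPoly (X : ℤ[X]))
    (natDegree_twinPoly X) (by rw [map_twinPoly]; exact ht)
  rw [map_coverPoly] at hu₀
  rw [map_twinPoly] at hv₀
  have hθint : IsIntegral ℤ[X] θ := by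
    refine ⟨X ^ 4 - 10 * X ^ 2 + 45, by monicity!, ?_⟩
    simp only [eval₂_add, eval₂_sub, eval₂_mul, eval₂_pow, eval₂_X, eval₂_ofNat, hθ]
    ring
  obtain ⟨κ, _, _, ψ, -, hs, -⟩ := exists_frobenius (K := K) (L := L) 3581 3503
  have hs' : ψ s = 3503 := hs.trans (Int.cast_ofNat 3503)
  obtain ⟨u, hu, hψu⟩ := exists_reindex ψ hu₀ coverResidues_cast_injective fun i => by
    rw [map_coverPoly, hs', isRoot_coverPoly]
    exact isCoverRoot_coverResidues i
  obtain ⟨v, hv, hψv⟩ := exists_reindex ψ hv₀ twinResidues_cast_injective fun i => by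
    rw [map_twinPoly, hs', isRoot_twinPoly]
    exact isTwinRoot_twinResidues i
  have hu' : ∀ x, IsCoverRoot s x ↔ ∃ i, u i = x := fun x => by
    rw [← isRoot_coverPoly, hu, isRoot_prod_iff]
  have hv' : ∀ x, IsTwinRoot s x ↔ ∃ i, v i = x := fun x => by
    rw [← isRoot_twinPoly, hv, isRoot_prod_iff]
  refine ⟨fun i => u i, fun i j h => coverResidues_cast_injective (κ := κ) ?_,
    aeval_coverPoly_eq_zero_iff hu, ?_⟩
  · simp only [← hψu, Subtype.ext h]
  refine card_eq_of_cycleTypes (hasFrobeniusType_cyclePerm11.meetsConjClass hu)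
    (hasFrobeniusType_cyclePerm10.meetsConjClass hu)
    (hasFrobeniusType_cyclePerm8.meetsConjClass hu)
    (hasFrobeniusType_cyclePerm6.meetsConjClass hu) (PreservesHadamard.card_le ?_)
  refine preservesHadamard (θ := (⟨θ, hθint⟩ : B)) hs' (fun i => (hu' _).2 ⟨i, rfl⟩)
    (fun i => (hv' _).2 ⟨i, rfl⟩) (fun x => (hv' x).1) hψu hψv (Subtype.ext hθ) ?_
  rintro π ⟨g, hg⟩
  let g' : B →ₐ[ℤ[X]] B := (g.toAlgHom.restrictScalars ℤ[X]).mapIntegralClosure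
  exact ⟨g', fun x y h => Subtype.ext (g.injective (congrArg Subtype.val h)), g'.commutes X,
    fun i => Subtype.ext (hg i)⟩

end card

theorem isFractionRing_int_polynomial {K : Type*} [Field K] [Algebra ℚ[X] K]
    [IsFractionRing ℚ[X] K] [Algebra ℤ[X] K]
    (h : ∀ F : ℤ[X], algebraMap ℤ[X] K F = algebraMap ℚ[X] K (F.map (algebraMap ℤ ℚ))) :
    IsFractionRing ℤ[X] K := by
  have hinj : Function.Injective (algebraMap ℤ[X] K) := fun F G hFG => by
    rw [h, h] at hFG
    exact map_injective _ (RingHom.injective_int (algebraMap ℤ ℚ))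
      (IsFractionRing.injective ℚ[X] K hFG)
  have : FaithfulSMul ℤ[X] K := (faithfulSMul_iff_algebraMap_injective _ _).2 hinj
  have hnum : ∀ f : ℚ[X], ∃ (b : ℤ) (F : ℤ[X]), b ≠ 0 ∧ F.map (algebraMap ℤ ℚ) = C (b : ℚ) * f :=
    fun f => by
      obtain ⟨b, hb, h⟩ := IsLocalization.integerNormalization_spec (nonZeroDivisors ℤ) f
      refine ⟨b, _, nonZeroDivisors.ne_zero hb, h.trans ?_⟩
      rw [← smul_eq_C_mul, Int.cast_smul_eq_zsmul]
  refine IsFractionRing.of_field _ _ fun z => ?_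
  obtain ⟨f, g, -, rfl⟩ := IsFractionRing.div_surjective ℚ[X] z
  obtain ⟨b, F, hb, hF⟩ := hnum f
  obtain ⟨c, G, hc, hG⟩ := hnum g
  refine ⟨C c * F, C b * G, ?_⟩
  have h0 : ∀ n : ℤ, n ≠ 0 → algebraMap ℚ[X] K (C (n : ℚ)) ≠ 0 := fun n hn => by
    rw [Ne, IsFractionRing.to_map_eq_zero_iff, C_eq_zero]
    exact_mod_cast hn
  rw [h, h, Polynomial.map_mul, Polynomial.map_mul, hF, hG, map_C, map_C, eq_intCast, eq_intCast,
    ← mul_assoc, ← mul_assoc, mul_comm (C (b : ℚ)), map_mul,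
    map_mul (algebraMap ℚ[X] K) _ g, mul_div_mul_left]
  rw [map_mul]
  exact mul_ne_zero (h0 c hc) (h0 b hb)

theorem card_gal_of_comp_eq_coverPoly {K : Type*} [Field K] [Algebra ℤ[X] K] [IsFractionRing ℤ[X] K]
    {f : K[X]} {c d : K} (hc : c ≠ 0) (hd : d ≠ 0)
    (hf : C c * f = (coverPoly (algebraMap ℤ[X] K X)).comp (C d * X)) :
    Nat.card f.Gal = 95040 := by
  have : CharZero K := charZero_of_injective_algebraMap (IsFractionRing.injective ℤ[X] K)
  let s : K := algebraMap ℤ[X] K X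
  let q : K[X] := X ^ 4 - 10 * X ^ 2 + 45
  have hq : q.natDegree = 4 := by
    simp only [q]
    compute_degree!
  have hq0 : q ≠ 0 := ne_zero_of_natDegree_gt (n := 0) (by omega)
  let P := coverPoly s * twinPoly s * q
  have hP : P ≠ 0 :=
    mul_ne_zero (mul_ne_zero (monic_coverPoly s).ne_zero (monic_twinPoly s).ne_zero) hq0
  let L := P.SplittingField
  have hsplit : ∀ g, g ∣ P → (g.map (algebraMap K L)).Splits := fun g hg =>
    (SplittingField.splits P).of_dvd (Polynomial.map_ne_zero hP) (Polynomial.map_dvd _ hg)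
  have hcs := hsplit (coverPoly s) ((dvd_mul_right _ _).mul_right _)
  have hts := hsplit (twinPoly s) ((dvd_mul_left _ _).mul_right _)
  obtain ⟨θ, hθ⟩ := (hsplit q (dvd_mul_left _ _)).exists_eval_eq_zero (by
    rw [degree_map, degree_eq_natDegree hq0, hq]
    norm_num)
  have hθ' : θ ^ 4 = 10 * θ ^ 2 - 45 := by
    simp only [q, Polynomial.map_add, Polynomial.map_sub, Polynomial.map_mul, Polynomial.map_pow,
      Polynomial.map_ofNat, map_X, eval_add, eval_sub, eval_mul, eval_pow, eval_ofNat, eval_X] at hθ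
    linear_combination hθ
  rw [map_coverPoly, ← IsScalarTower.algebraMap_apply] at hcs
  rw [map_twinPoly, ← IsScalarTower.algebraMap_apply] at hts
  have : IsGalois K L := {}
  obtain ⟨u, hinj, hu, hcard⟩ := exists_coverRoots_card_rootPerms (K := K) hcs hts hθ'
  have he : algebraMap K L d ≠ 0 := (_root_.map_ne_zero _).2 hd
  have hroot : ∀ x : L, aeval x f = 0 ↔ ∃ i, u i / algebraMap K L d = x := fun x => by
    have h := congrArg (aeval x) hf
    rw [aeval_comp, map_mul, map_mul, aeval_C, aeval_C, aeval_X] at h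
    rw [← mul_eq_zero_iff_left ((_root_.map_ne_zero (algebraMap K L)).2 hc), h, hu]
    simp only [div_eq_iff he, mul_comm]
  have hcomp : (coverPoly s).comp (C d * X) ≠ 0 := fun h => by
    have h' := natDegree_comp (p := coverPoly s) (q := C d * X)
    rw [h, natDegree_coverPoly, natDegree_C_mul_X d hd, natDegree_zero] at h'
    omega
  have hf0 : f ≠ 0 := right_ne_zero_of_mul (hf.trans_ne hcomp)
  have hfs : (f.map (algebraMap K L)).Splits := by
    refine Splits.of_dvd (g := ((coverPoly s).comp (C d * X)).map (algebraMap K L)) ?_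
      (Polynomial.map_ne_zero hcomp) (Polynomial.map_dvd _ (hf ▸ dvd_mul_left _ _))
    rw [map_comp, map_coverPoly, ← IsScalarTower.algebraMap_apply]
    refine hcs.comp_of_natDegree_le_one ?_
    rw [Polynomial.map_mul, map_C, map_X]
    exact (natDegree_C_mul_le _ _).trans natDegree_X_le
  rw [card_gal_eq_card_rootPerms (L := L) hf0 hfs (fun i j h => hinj ((div_left_inj' he).1 h))
    hroot, ← hcard]
  congr 2
  ext π
  refine exists_congr fun g => forall_congr' fun i => ?_
  rw [map_div₀, AlgEquiv.commutes, div_left_inj' he]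

/-- The polynomial `f_{B^t}(s,x)` has Galois group over `ℚ(s)` of order
`95040`, the order of the Mathieu group `M₁₂`. -/
theorem galois_group_of_fBt_has_card_M12 :
    let s : Polynomial (RatFunc ℚ) := C RatFunc.X
    let fBt : Polynomial (RatFunc ℚ) :=
      5 ^ 2 * (2500 * X ^ 12 - 45000 * X ^ 10 + 310500 * X ^ 8 - 1001700 * X ^ 6
          + 1433700 * X ^ 4 - 641520 * X ^ 2 + 174960 * X + 88209)
        - 270 * s * (12 * X + 25) * (50 * X ^ 6 - 450 * X ^ 4 + 1080 * X ^ 2 - 297)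
        + 3 ^ 6 * s ^ 2 * (12 * X - 25) ^ 2
    Nat.card fBt.Gal = 95040 := by
  intro s fBt
  let _ : Algebra ℤ[X] (RatFunc ℚ) :=
    ((algebraMap ℚ[X] (RatFunc ℚ)).comp (mapRingHom (algebraMap ℤ ℚ))).toAlgebra
  have : IsFractionRing ℤ[X] (RatFunc ℚ) := isFractionRing_int_polynomial fun _ => rfl
  have hX : algebraMap ℤ[X] (RatFunc ℚ) X = RatFunc.X := by
    rw [RingHom.algebraMap_toAlgebra, RingHom.comp_apply, coe_mapRingHom, map_X,
      RatFunc.algebraMap_X]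
  refine card_gal_of_comp_eq_coverPoly (c := 16000000) (d := 10) (by norm_num) (by norm_num) ?_
  rw [hX]
  simp only [s, fBt, coverPoly, intEval, coverCoeffs0, coverCoeffs1, coverCoeffs2, listEval,
    add_comp, mul_comp, pow_comp, C_comp, X_comp, intCast_comp, zero_comp, map_ofNat]
  push_cast
  ring
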